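/- arXiv:1503.03837 — 2 statements merged into one kernel-verified Lean document; each statement's English description precedes it below -/
import Mathlib

section
/- For every oriented connected compact n-manifold M (with possibly empty boundary) and every ε > 0, there exists an integral relative cycle z ∈ C_n(M, ∂M; ℤ) and a positive integer d with [z] = d·[M, ∂M]_ℤ such that ‖z‖_ℤ / d ≤ ‖M, ∂M‖ + ε. -/
/- Minimal development of singular chains, ℓ¹-norms, and relative homology seminorms. -/

open scoped BigOperators
noncomputable section

/-- The topological standard `n`-simplex. -/
abbrev TopSimplex (n : ℕ) : Type := (stdSimplex ℝ (Fin (n + 1)) : Set (Fin (n + 1) → ℝ))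

/-- Singular `n`-simplices of a topological space `X`. -/
abbrev SingularSimplex (n : ℕ) (X : Type*) [TopologicalSpace X] : Type _ :=
  C(TopSimplex n, X)

/-- The `i`-th face inclusion of the standard `n`-simplex into the standard `n+1`-simplex. -/
def faceIncl {n : ℕ} (i : Fin (n + 2)) : C(TopSimplex n, TopSimplex (n + 1)) where
  toFun x := ⟨i.insertNth 0 x.1, by
    constructor
    · intro j
      refine i.succAboveCases ?_ (fun j => ?_) j
      · simp
      · simpa using x.2.1 j
    · rw [Fin.sum_univ_succAbove _ i]
      simpa using x.2.2⟩
  continuous_toFun := by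
    apply Continuous.subtype_mk
    refine continuous_pi fun j => ?_
    refine i.succAboveCases (α := fun j => Continuous fun x : TopSimplex n =>
      Fin.insertNth (α := fun _ => ℝ) i 0 x.1 j) ?_ (fun j => ?_) j
    · simp only [Fin.insertNth_apply_same]
      exact continuous_const
    · simp only [Fin.insertNth_apply_succAbove]
      exact (continuous_apply _).comp continuous_subtype_val

/-- Singular `n`-chains of `X` with coefficients in `R`, as finitely supported functions
on singular simplices. -/
abbrev SingularChain (n : ℕ) (X : Type*) [TopologicalSpace X] (R : Type*) [Ring R] :
    Type _ := SingularSimplex n X →₀ R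

variable {X : Type*} [TopologicalSpace X] {R : Type*}

/-- The boundary operator on singular chains. -/
def chainBoundary [Ring R] : ∀ {n : ℕ}, SingularChain n X R → SingularChain (n - 1) X R
  | 0, _ => 0
  | (_ + 1), c =>
      c.sum fun σ a => ∑ i, Finsupp.single (σ.comp (faceIncl i)) (a * (-1) ^ (i : ℕ))

/-- A singular simplex is supported in the subspace `Y`. -/
def SimplexIn {n : ℕ} (Y : Set X) (σ : SingularSimplex n X) : Prop := Set.range σ ⊆ Y

open scoped Classical in
/-- The relative ℓ¹-norm of a chain: the sum of the absolute values of the coefficients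
of the simplices not supported in `Y`. -/
def relNorm [NormedRing R] {n : ℕ} (Y : Set X) (c : SingularChain n X R) : ℝ :=
  ∑ σ ∈ c.support, if SimplexIn Y σ then 0 else ‖c σ‖

/-- `c` is a relative cycle of the pair `(X, Y)`: its boundary is supported in `Y`. -/
def IsRelCycle [Ring R] {n : ℕ} (Y : Set X) (c : SingularChain n X R) : Prop :=
  ∀ σ, ¬ SimplexIn Y σ → chainBoundary c σ = 0

/-- The boundary operator on `(n+1)`-chains, with its natural target. -/
def chainBoundarySucc [Ring R] {n : ℕ} (c : SingularChain (n + 1) X R) :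
    SingularChain n X R :=
  chainBoundary c

/-- Two relative chains are homologous in the pair `(X, Y)`: their difference is a
boundary, up to chains supported in `Y`.  In particular `[z] = [w]` in `H_n(X, Y; R)`. -/
def RelHomologous [Ring R] {n : ℕ} (Y : Set X) (z w : SingularChain n X R) : Prop :=
  ∃ b : SingularChain (n + 1) X R, ∀ σ, ¬ SimplexIn Y σ → (z - w - chainBoundarySucc b) σ = 0

/-- The ℓ¹-seminorm of the relative homology class of the chain `z`:
the infimum of the relative ℓ¹-norms of the chains homologous to `z`. -/
def classNorm [NormedRing R] {n : ℕ} (Y : Set X) (z : SingularChain n X R) : ℝ :=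
  sInf {r : ℝ | ∃ w : SingularChain n X R, RelHomologous Y z w ∧ r = relNorm Y w}

/-- Change of coefficients from rational chains to real chains. -/
def chainToReal {n : ℕ} (c : SingularChain n X ℚ) : SingularChain n X ℝ :=
  c.mapRange Rat.cast (by simp)

/-- Change of coefficients from integral chains to real chains. -/
def intChainToReal {n : ℕ} (c : SingularChain n X ℤ) : SingularChain n X ℝ :=
  c.mapRange Int.cast (by simp)

/-- Pushforward of chains along a continuous map. -/
def chainMap [Ring R] {Y : Type*} [TopologicalSpace Y] {n : ℕ} (f : C(X, Y))
    (c : SingularChain n X R) : SingularChain n Y R :=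
  c.sum fun σ a => Finsupp.single (f.comp σ) a

end

section SingularChains

variable {X : Type*} [TopologicalSpace X] {R : Type*}

theorem faceIncl_comp_faceIncl {n : ℕ} (i : Fin (n + 3)) (j : Fin (n + 2)) :
    (faceIncl i).comp (faceIncl j) =
      (faceIncl (i.succAbove j)).comp (faceIncl (n := n) (j.predAbove i)) := by
  ext x k
  change i.insertNth (α := fun _ => ℝ) 0 (j.insertNth (α := fun _ => ℝ) 0 x.1) k =
    (i.succAbove j).insertNth (α := fun _ => ℝ) 0
      ((j.predAbove i).insertNth (α := fun _ => ℝ) 0 x.1) k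
  refine congrFun ?_ k
  rw [Fin.insertNth_eq_iff]
  constructor
  · conv_rhs => arg 4; rw [← Fin.succAbove_succAbove_predAbove i j]
    simp
  · rw [Fin.insertNth_eq_iff]
    refine ⟨by simp [Fin.removeNth], ?_⟩
    ext l
    simp only [Fin.removeNth, ← Fin.succAbove_succAbove_succAbove_predAbove i j l,
      Fin.insertNth_apply_succAbove]

theorem chainBoundarySucc_eq_sum [Ring R] {n : ℕ} (c : SingularChain (n + 1) X R) :
    chainBoundarySucc c =
      c.sum fun σ a => ∑ i, Finsupp.single (σ.comp (faceIncl i)) (a * (-1) ^ (i : ℕ)) :=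
  rfl

theorem chainBoundarySucc_single [Ring R] {n : ℕ} (σ : SingularSimplex (n + 1) X) (a : R) :
    chainBoundarySucc (Finsupp.single σ a) =
      ∑ i, Finsupp.single (σ.comp (faceIncl i)) (a * (-1) ^ (i : ℕ)) := by
  rw [chainBoundarySucc_eq_sum, Finsupp.sum_single_index (by simp)]

theorem chainBoundarySucc_add [Ring R] {n : ℕ} (b c : SingularChain (n + 1) X R) :
    chainBoundarySucc (b + c) = chainBoundarySucc b + chainBoundarySucc c := by
  simp only [chainBoundarySucc_eq_sum]
  exact Finsupp.sum_add_index' (by simp)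
    (by simp only [add_mul, Finsupp.single_add, Finset.sum_add_distrib, implies_true])

/-- The boundary operator in positive degrees, as an additive homomorphism. -/
noncomputable def chainBoundaryHom (n : ℕ) (X : Type*) [TopologicalSpace X] (R : Type*) [Ring R] :
    SingularChain (n + 1) X R →+ SingularChain n X R :=
  AddMonoidHom.mk' chainBoundarySucc chainBoundarySucc_add

theorem chainBoundaryHom_single [Ring R] {n : ℕ} (σ : SingularSimplex (n + 1) X) (a : R) :
    chainBoundaryHom n X R (Finsupp.single σ a) =
      ∑ i, Finsupp.single (σ.comp (faceIncl i)) (a * (-1) ^ (i : ℕ)) :=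
  chainBoundarySucc_single σ a

theorem chainBoundaryHom_comp_self [Ring R] (n : ℕ) :
    (chainBoundaryHom n X R).comp (chainBoundaryHom (n + 1) X R) = 0 := by
  refine Finsupp.addHom_ext fun σ a => ?_
  simp only [AddMonoidHom.comp_apply, chainBoundaryHom_single, map_sum, AddMonoidHom.zero_apply]
  rw [← Finset.sum_product']
  refine Finset.sum_involution
    (fun p _ => (p.1.succAbove p.2, p.2.predAbove p.1)) ?_ ?_ (by simp) ?_
  · rintro ⟨i, j⟩ -
    have hsign := Fin.neg_one_pow_succAbove_add_predAbove (R := R) i j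
    dsimp only
    rw [ContinuousMap.comp_assoc, ContinuousMap.comp_assoc, ← faceIncl_comp_faceIncl,
      ← Finsupp.single_add, mul_assoc, mul_assoc, ← pow_add, ← pow_add, hsign]
    simp
  · rintro ⟨i, j⟩ - - h
    exact Fin.succAbove_ne i j (congrArg Prod.fst h)
  · rintro ⟨i, j⟩ -
    exact Prod.ext (Fin.succAbove_succAbove_predAbove i j) (Fin.predAbove_predAbove_succAbove i j)

/-- Change of coefficients from integral to real chains, as an additive homomorphism. -/
noncomputable def intChainToRealHom (n : ℕ) (X : Type*) [TopologicalSpace X] :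
    SingularChain n X ℤ →+ SingularChain n X ℝ :=
  Finsupp.mapRange.addMonoidHom (Int.castAddHom ℝ)

theorem intChainToRealHom_apply {n : ℕ} (c : SingularChain n X ℤ) :
    intChainToRealHom n X c = intChainToReal c := rfl

theorem intChainToRealHom_comp_chainBoundaryHom (n : ℕ) :
    (intChainToRealHom n X).comp (chainBoundaryHom n X ℤ) =
      (chainBoundaryHom n X ℝ).comp (intChainToRealHom (n + 1) X) := by
  refine Finsupp.addHom_ext fun σ a => ?_
  simp [chainBoundaryHom_single, intChainToRealHom, -Finsupp.single_mul]

section Norm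

open scoped Classical in
theorem relNorm_eq_sum_of_subset [NormedRing R] {n : ℕ} (Y : Set X) {c : SingularChain n X R}
    {s : Finset (SingularSimplex n X)} (hs : c.support ⊆ s) :
    relNorm Y c = ∑ σ ∈ s, if SimplexIn Y σ then 0 else ‖c σ‖ :=
  Finset.sum_subset hs fun σ _ hσ => by simp [Finsupp.notMem_support_iff.mp hσ]

theorem relNorm_congr [NormedRing R] {n : ℕ} {Y : Set X} {c c' : SingularChain n X R}
    (h : ∀ σ, ¬ SimplexIn Y σ → c σ = c' σ) : relNorm Y c = relNorm Y c' := by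
  classical
  rw [relNorm_eq_sum_of_subset Y (Finset.subset_union_left (s₂ := c'.support)),
    relNorm_eq_sum_of_subset Y (Finset.subset_union_right (s₁ := c.support))]
  refine Finset.sum_congr rfl fun σ _ => ?_
  split_ifs with hσ
  · rfl
  · rw [h σ hσ]

theorem relNorm_add_le [NormedRing R] {n : ℕ} (Y : Set X) (c c' : SingularChain n X R) :
    relNorm Y (c + c') ≤ relNorm Y c + relNorm Y c' := by
  classical
  rw [relNorm_eq_sum_of_subset Y Finsupp.support_add,
    relNorm_eq_sum_of_subset Y (Finset.subset_union_left (s₂ := c'.support)),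
    relNorm_eq_sum_of_subset Y (Finset.subset_union_right (s₁ := c.support)),
    ← Finset.sum_add_distrib]
  refine Finset.sum_le_sum fun σ _ => ?_
  split_ifs
  · simp
  · exact norm_add_le _ _

theorem relNorm_single_le [NormedRing R] {n : ℕ} (Y : Set X) (σ : SingularSimplex n X) (a : R) :
    relNorm Y (Finsupp.single σ a) ≤ ‖a‖ := by
  classical
  rw [relNorm_eq_sum_of_subset Y Finsupp.support_single_subset, Finset.sum_singleton]
  split_ifs <;> simp

theorem relNorm_sum_le [NormedRing R] {n : ℕ} (Y : Set X) {ι : Type*} (s : Finset ι)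
    (c : ι → SingularChain n X R) : relNorm Y (∑ i ∈ s, c i) ≤ ∑ i ∈ s, relNorm Y (c i) :=
  Finset.le_sum_of_subadditive _ (by simp [relNorm]) (relNorm_add_le Y) s c

theorem relNorm_smul {n : ℕ} (Y : Set X) (r : ℝ) (c : SingularChain n X ℝ) :
    relNorm Y (r • c) = |r| * relNorm Y c := by
  classical
  rw [relNorm_eq_sum_of_subset Y Finsupp.support_smul, relNorm, Finset.mul_sum]
  refine Finset.sum_congr rfl fun σ _ => ?_
  split_ifs <;> simp

theorem relNorm_intChainToReal {n : ℕ} (Y : Set X) (c : SingularChain n X ℤ) :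
    relNorm Y (intChainToReal c) = relNorm Y c := by
  classical
  rw [relNorm_eq_sum_of_subset Y (Finsupp.support_mapRange (hf := Int.cast_zero)), relNorm]
  refine Finset.sum_congr rfl fun σ _ => ?_
  simp [intChainToReal, Int.norm_eq_abs]

theorem relNorm_chainBoundaryHom_le {n : ℕ} (Y : Set X) (c : SingularChain (n + 1) X ℝ) :
    relNorm Y (chainBoundaryHom n X ℝ c) ≤ (n + 2) * ∑ σ ∈ c.support, ‖c σ‖ := by
  have hc : chainBoundaryHom n X ℝ c =
      ∑ σ ∈ c.support, ∑ i, Finsupp.single (σ.comp (faceIncl i)) (c σ * (-1) ^ (i : ℕ)) := rfl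
  rw [hc, Finset.mul_sum]
  refine (relNorm_sum_le Y _ _).trans (Finset.sum_le_sum fun σ _ => ?_)
  refine (relNorm_sum_le Y _ _).trans ?_
  refine (Finset.sum_le_sum fun i _ => relNorm_single_le Y _ _).trans ?_
  simp

end Norm

theorem isRelCycle_zsmul_sub_chainBoundaryHom [Ring R] {n : ℕ} {Y : Set X}
    {c : SingularChain n X R} (hc : IsRelCycle Y c) (d : ℤ) (b : SingularChain (n + 1) X R) :
    IsRelCycle Y (d • c - chainBoundaryHom n X R b) := by
  cases n with
  | zero => exact fun σ _ => rfl
  | succ n =>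
    intro σ hσ
    change chainBoundaryHom n X R (d • c - chainBoundaryHom (n + 1) X R b) σ = 0
    have hb := DFunLike.congr_fun (chainBoundaryHom_comp_self (X := X) (R := R) n) b
    have hcσ : chainBoundaryHom n X R c σ = 0 := hc σ hσ
    rw [AddMonoidHom.comp_apply, AddMonoidHom.zero_apply] at hb
    rw [map_sub, map_zsmul, hb]
    simp [hcσ]

theorem exists_relNorm_sub_chainBoundaryHom_lt {n : ℕ} (Y : Set X) (c : SingularChain n X ℝ)
    {ε : ℝ} (hε : 0 < ε) :
    ∃ b, relNorm Y (c - chainBoundaryHom n X ℝ b) < classNorm Y c + ε := by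
  obtain ⟨_, ⟨w, ⟨b, hb⟩, rfl⟩, hw⟩ := Real.lt_sInf_add_pos
    (s := {r : ℝ | ∃ w : SingularChain n X ℝ, RelHomologous Y c w ∧ r = relNorm Y w})
    ⟨_, c, ⟨0, by simp [chainBoundarySucc, chainBoundary]⟩, rfl⟩ hε
  refine ⟨b, lt_of_eq_of_lt (relNorm_congr fun σ hσ => ?_) hw⟩
  have h := hb σ hσ
  change c σ - chainBoundarySucc b σ = w σ
  simp only [Finsupp.sub_apply] at h
  linarith

/-- A multiple of a real chain is approximated by an integral chain up to an error in the
boundary independent of the multiple. -/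
theorem exists_intChain_relNorm_chainBoundaryHom_le {n : ℕ} (Y : Set X)
    (b : SingularChain (n + 1) X ℝ) (t : ℝ) :
    ∃ B : SingularChain (n + 1) X ℤ,
      relNorm Y (chainBoundaryHom n X ℝ (t • b - intChainToReal B)) ≤
        (n + 2) * b.support.card := by
  refine ⟨b.mapRange (fun x => ⌊t * x⌋) (by simp), ?_⟩
  refine (relNorm_chainBoundaryHom_le Y _).trans ?_
  gcongr
  refine (Finset.sum_le_card_nsmul _ _ 1 fun σ _ => ?_).trans ?_
  · have : |Int.fract (t * b σ)| ≤ 1 := by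
      rw [Int.abs_fract]
      exact (Int.fract_lt_one _).le
    simpa [intChainToReal] using this
  · rw [nsmul_one]
    refine Nat.cast_le.mpr (Finset.card_le_card fun σ hσ => ?_)
    contrapose! hσ
    simp_all [intChainToReal]

end SingularChains


/-- Let `M` be an oriented connected compact `n`-manifold with (possibly
empty) boundary `bM`, with integral relative fundamental cycle `zfund` (so that the real
simplicial volume is `‖M, ∂M‖ = classNorm bM (intChainToReal zfund)`).  For every `ε > 0`
there are an integral relative cycle `z` and an integer `d > 0` with `[z] = d • [M, ∂M]_ℤ`
and `‖z‖_ℤ / d ≤ ‖M, ∂M‖ + ε`. -/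
theorem exists_efficient_integral_cycle {M : Type*} [TopologicalSpace M] [CompactSpace M]
    [T2Space M] [ConnectedSpace M] (bM : Set M) (n : ℕ)
    (zfund : SingularChain n M ℤ) (hfund : IsRelCycle bM zfund)
    (ε : ℝ) (hε : 0 < ε) :
    ∃ (z : SingularChain n M ℤ) (d : ℤ), 0 < d ∧ IsRelCycle bM z ∧
      RelHomologous bM z (d • zfund) ∧
      relNorm bM z / (d : ℝ) ≤ classNorm bM (intChainToReal zfund) + ε := by
  obtain ⟨b, hb⟩ := exists_relNorm_sub_chainBoundaryHom_lt bM (intChainToReal zfund) (half_pos hε)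
  obtain ⟨d, hd⟩ := exists_nat_gt ((n + 2) * b.support.card / (ε / 2) : ℝ)
  have hd0 : (0 : ℝ) < d := lt_of_le_of_lt (by positivity) hd
  obtain ⟨B, hB⟩ := exists_intChain_relNorm_chainBoundaryHom_le bM b d
  refine ⟨(d : ℤ) • zfund - chainBoundaryHom n M ℤ B, d, by exact_mod_cast hd0,
    isRelCycle_zsmul_sub_chainBoundaryHom hfund _ _, ⟨-B, fun σ _ => ?_⟩, ?_⟩
  · change ((d : ℤ) • zfund - chainBoundaryHom n M ℤ B - (d : ℤ) • zfund -
      chainBoundaryHom n M ℤ (-B)) σ = 0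
    simp
  · have hcomm : intChainToReal (chainBoundaryHom n M ℤ B) =
        chainBoundaryHom n M ℝ (intChainToReal B) :=
      DFunLike.congr_fun (intChainToRealHom_comp_chainBoundaryHom n) B
    have hsmul : chainBoundaryHom n M ℝ ((d : ℝ) • b) = (d : ℝ) • chainBoundaryHom n M ℝ b := by
      rw [Nat.cast_smul_eq_nsmul, Nat.cast_smul_eq_nsmul, map_nsmul]
    have hdecomp : intChainToReal ((d : ℤ) • zfund - chainBoundaryHom n M ℤ B) =
        (d : ℝ) • (intChainToReal zfund - chainBoundaryHom n M ℝ b) +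
          chainBoundaryHom n M ℝ ((d : ℝ) • b - intChainToReal B) := by
      rw [map_sub, hsmul, ← hcomm, smul_sub, sub_add_sub_cancel, ← intChainToRealHom_apply,
        map_sub, map_zsmul, natCast_zsmul, Nat.cast_smul_eq_nsmul, intChainToRealHom_apply,
        intChainToRealHom_apply]
    rw [← relNorm_intChainToReal, hdecomp, Int.cast_natCast, div_le_iff₀ hd0]
    refine (relNorm_add_le _ _ _).trans ?_
    rw [relNorm_smul, Nat.abs_cast]
    rw [div_lt_iff₀ (half_pos hε)] at hd
    nlinarith [mul_le_mul_of_nonneg_left hb.le hd0.le]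
end

section
/- If Δ is a 2-obtuse geodesic 3-simplex in hyperbolic 3-space (nondegenerate, with nonideal vertices, having two edges sharing a vertex that both subtend nonacute dihedral angles), then vol(Δ) ≤ v₃/2, where v₃ is the volume of the regular ideal hyperbolic 3-simplex. -/
open Real
noncomputable section

/-! We work in the Klein (projective) model of hyperbolic 3-space: points are the points
of the open unit ball of `ℝ³`, geodesics are Euclidean segments, so geodesic simplices are
Euclidean simplices.  Dihedral angles are computed in the hyperboloid model via the
Minkowski bilinear form on `ℝ⁴`, using outward spacelike normals of the faces. -/

/-- The Minkowski bilinear form of signature `(-,+,+,+)` on `ℝ⁴`. -/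
def mink (x y : Fin 4 → ℝ) : ℝ := -(x 0 * y 0) + x 1 * y 1 + x 2 * y 2 + x 3 * y 3

/-- The (projective) lift of a point of the Klein ball to `ℝ⁴`. -/
def kleinLift (p : EuclideanSpace ℝ (Fin 3)) : Fin 4 → ℝ := ![1, p 0, p 1, p 2]

/-- A geodesic 3-simplex in hyperbolic 3-space with nonideal vertices, in the Klein model:
the convex hull of `4` affinely independent points of the open unit ball ("nondegenerate"
means not contained in a plane, i.e. affinely independent vertices). -/
structure GeodesicSimplex3 where
  v : Fin 4 → EuclideanSpace ℝ (Fin 3)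
  mem_ball : ∀ i, ‖v i‖ < 1
  indep : AffineIndependent ℝ v

/-- An outward spacelike Minkowski normal of the face of `Δ` opposite to the vertex `k`:
Minkowski-orthogonal to the lifts of the other three vertices, negative on the lift of the
omitted vertex `k`, and spacelike.  (It is unique up to a positive scalar; we choose one.) -/
def outwardNormal (Δ : GeodesicSimplex3) (k : Fin 4) : Fin 4 → ℝ :=
  Classical.epsilon fun nv =>
    (∀ a, a ≠ k → mink nv (kleinLift (Δ.v a)) = 0) ∧
      mink nv (kleinLift (Δ.v k)) < 0 ∧ 0 < mink nv nv

/-- The dihedral angle of `Δ` between the faces opposite to the vertices `k` and `l`,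
i.e. the dihedral angle at the edge joining the remaining two vertices, computed by the
standard formula `cos α = -⟨n_k, n_l⟩/√(⟨n_k,n_k⟩⟨n_l,n_l⟩)` for outward normals. -/
def dihedralAngleFaces (Δ : GeodesicSimplex3) (k l : Fin 4) : ℝ :=
  arccos (-(mink (outwardNormal Δ k) (outwardNormal Δ l)) /
    sqrt (mink (outwardNormal Δ k) (outwardNormal Δ k) *
      mink (outwardNormal Δ l) (outwardNormal Δ l)))

/-- The edge of `Δ` joining the vertices `i ≠ j` subtends a nonacute (`≥ π/2`) dihedral
angle: the dihedral angle between the two faces containing this edge — the faces opposite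
to the two remaining vertices `k`, `l` — is at least `π/2`. -/
def SubtendsNonacute (Δ : GeodesicSimplex3) (i j : Fin 4) : Prop :=
  ∃ k l : Fin 4, ({i, j, k, l} : Finset (Fin 4)) = Finset.univ ∧
    π / 2 ≤ dihedralAngleFaces Δ k l

end

noncomputable section

/-- The hyperbolic volume of a subset of the Klein ball:
`vol(s) = ∫_s (1 - ‖x‖²)⁻² dx`. -/
def hypVolume (s : Set (EuclideanSpace ℝ (Fin 3))) : ℝ :=
  ∫ x in s, ((1 - ‖x‖ ^ 2) ^ 2)⁻¹

/-- The hyperbolic volume of a geodesic 3-simplex. -/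
def GeodesicSimplex3.volume (Δ : GeodesicSimplex3) : ℝ :=
  hypVolume (convexHull ℝ (Set.range Δ.v))

/-- The Lobachevsky function `L(θ) = -∫₀^θ log |2 sin u| du`. -/
def lobachevsky (θ : ℝ) : ℝ := -∫ u in (0:ℝ)..θ, log |2 * sin u|

/-- `v₃ = 3·L(π/3)`, the volume of the regular ideal hyperbolic 3-simplex (the maximal
volume of a geodesic 3-simplex). -/
def v₃ : ℝ := 3 * lobachevsky (π / 3)

lemma mink_comm (x y : Fin 4 → ℝ) : mink x y = mink y x := by
  simp only [mink]; ring

lemma mink_add_left (x y z : Fin 4 → ℝ) : mink (x + y) z = mink x z + mink y z := by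
  simp only [mink, Pi.add_apply]; ring

lemma mink_sub_left (x y z : Fin 4 → ℝ) : mink (x - y) z = mink x z - mink y z := by
  simp only [mink, Pi.sub_apply]; ring

lemma mink_smul_left (c : ℝ) (x y : Fin 4 → ℝ) : mink (c • x) y = c * mink x y := by
  simp only [mink, Pi.smul_apply, smul_eq_mul]; ring

lemma mink_add_right (x y z : Fin 4 → ℝ) : mink x (y + z) = mink x y + mink x z := by
  simp only [mink, Pi.add_apply]; ring

lemma mink_sub_right (x y z : Fin 4 → ℝ) : mink x (y - z) = mink x y - mink x z := by
  simp only [mink, Pi.sub_apply]; ring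

lemma mink_smul_right (c : ℝ) (x y : Fin 4 → ℝ) : mink x (c • y) = c * mink x y := by
  simp only [mink, Pi.smul_apply, smul_eq_mul]; ring

/-- A nonzero vector Minkowski-orthogonal to a timelike vector is spacelike. -/
lemma mink_self_pos_of_orthogonal {w x : Fin 4 → ℝ} (hw : mink w w < 0) (hwx : mink w x = 0)
    (hx : x ≠ 0) : 0 < mink x x := by
  simp only [mink] at *
  have hcs : (w 1 * x 1 + w 2 * x 2 + w 3 * x 3) ^ 2 ≤
      (w 1 ^ 2 + w 2 ^ 2 + w 3 ^ 2) * (x 1 ^ 2 + x 2 ^ 2 + x 3 ^ 2) := by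
    nlinarith [sq_nonneg (w 1 * x 2 - w 2 * x 1), sq_nonneg (w 1 * x 3 - w 3 * x 1),
      sq_nonneg (w 2 * x 3 - w 3 * x 2)]
  have h0 : w 1 * x 1 + w 2 * x 2 + w 3 * x 3 = w 0 * x 0 := by linarith
  rw [h0] at hcs
  have hw0 : 0 < w 0 ^ 2 := by nlinarith [sq_nonneg (w 1), sq_nonneg (w 2), sq_nonneg (w 3)]
  have hX : 0 < x 1 ^ 2 + x 2 ^ 2 + x 3 ^ 2 := by
    by_contra hX
    have h1 : x 1 = 0 := by nlinarith [sq_nonneg (x 1), sq_nonneg (x 2), sq_nonneg (x 3)]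
    have h2 : x 2 = 0 := by nlinarith [sq_nonneg (x 1), sq_nonneg (x 2), sq_nonneg (x 3)]
    have h3 : x 3 = 0 := by nlinarith [sq_nonneg (x 1), sq_nonneg (x 2), sq_nonneg (x 3)]
    have h4 : w 0 * x 0 = 0 := by rw [← h0, h1, h2, h3]; ring
    have h5 : x 0 = 0 := (mul_eq_zero.1 h4).resolve_left (by rintro h; rw [h] at hw0; simp at hw0)
    exact hx (by ext i; fin_cases i <;> simp [*])
  by_contra hcon
  have h6 : x 1 ^ 2 + x 2 ^ 2 + x 3 ^ 2 ≤ x 0 ^ 2 := by linarith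
  nlinarith [mul_le_mul_of_nonneg_left h6 hw0.le, mul_pos hX (show 0 < w 0 ^ 2 -
    (w 1 ^ 2 + w 2 ^ 2 + w 3 ^ 2) by linarith)]

lemma mink_kleinLift_neg {p q : EuclideanSpace ℝ (Fin 3)} (hp : ‖p‖ < 1) (hq : ‖q‖ < 1) :
    mink (kleinLift p) (kleinLift q) < 0 := by
  have h : inner ℝ p q < 1 := by
    have := real_inner_le_norm p q
    nlinarith [norm_nonneg p, norm_nonneg q]
  simp only [PiLp.inner_apply, Fin.sum_univ_three] at h
  simp [mink, kleinLift] at *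
  linarith

/-- `e` is an orthonormal frame for the Minkowski form, with `e 0` timelike. -/
structure IsLorentzFrame (e : Fin 4 → Fin 4 → ℝ) : Prop where
  e00 : mink (e 0) (e 0) = -1
  e11 : mink (e 1) (e 1) = 1
  e22 : mink (e 2) (e 2) = 1
  e33 : mink (e 3) (e 3) = 1
  e01 : mink (e 0) (e 1) = 0
  e02 : mink (e 0) (e 2) = 0
  e03 : mink (e 0) (e 3) = 0
  e12 : mink (e 1) (e 2) = 0
  e13 : mink (e 1) (e 3) = 0
  e23 : mink (e 2) (e 3) = 0

/-- The cone over the simplex with vertices `e 0`, `e 0 + e 3` and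
`e 0 + cos α • e 1 ± sin α • e 2`. -/
def frameCone (e : Fin 4 → Fin 4 → ℝ) (α : ℝ) : Set (Fin 4 → ℝ) :=
  {x | 0 < -mink (e 0) x - mink (e 3) x ∧ 0 ≤ mink (e 3) x ∧
    mink (e 1) x ≤ cos α * (-mink (e 0) x - mink (e 3) x) ∧
    mink (e 2) x * cos α ≤ mink (e 1) x * sin α ∧
    -(mink (e 2) x * cos α) ≤ mink (e 1) x * sin α}

lemma frameCone_add {e : Fin 4 → Fin 4 → ℝ} {α : ℝ} {x y : Fin 4 → ℝ}
    (hx : x ∈ frameCone e α) (hy : y ∈ frameCone e α) : x + y ∈ frameCone e α := by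
  obtain ⟨h1, h2, h3, h4, h5⟩ := hx
  obtain ⟨k1, k2, k3, k4, k5⟩ := hy
  simp only [frameCone, Set.mem_ofPred_eq, mink_add_right]
  refine ⟨?_, ?_, ?_, ?_, ?_⟩ <;> linarith

lemma frameCone_smul {e : Fin 4 → Fin 4 → ℝ} {α c : ℝ} {x : Fin 4 → ℝ} (hc : 0 < c)
    (hx : x ∈ frameCone e α) : c • x ∈ frameCone e α := by
  obtain ⟨h1, h2, h3, h4, h5⟩ := hx
  simp only [frameCone, Set.mem_ofPred_eq, mink_smul_right]
  refine ⟨?_, ?_, ?_, ?_, ?_⟩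
  · nlinarith
  · positivity
  · nlinarith
  · nlinarith
  · nlinarith

/-- Decomposition of a timelike vector into a unit spacelike component and a component along a
given timelike vector `w`. -/
lemma exists_unit_component {w n I : Fin 4 → ℝ} (hww : mink w w < 0) (hnw : mink n w = 0)
    (hnI : mink n I = 0) (hII : mink I I < 0) (hwI : mink w I < 0) (hne : ∀ z : ℝ, I ≠ z • w) :
    ∃ (u : Fin 4 → ℝ) (r s : ℝ), 0 < r ∧ r < s * √(-mink w w) ∧
      I = r • u + s • w ∧ mink u u = 1 ∧ mink w u = 0 ∧ mink n u = 0 := by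
  set s := mink w I / mink w w with hs
  have hsw : s * mink w w = mink w I := by rw [hs, div_mul_cancel₀ _ hww.ne]
  have hspos : 0 < s := div_pos_of_neg_of_neg hwI hww
  set d := I - s • w with hd
  have hwd : mink w d = 0 := by rw [hd, mink_sub_right, mink_smul_right, hsw]; ring
  have hdd : 0 < mink d d := by
    refine mink_self_pos_of_orthogonal hww hwd ?_
    intro h0
    exact hne s (by rw [hd, sub_eq_zero] at h0; exact h0)
  have hr : 0 < √(mink d d) := Real.sqrt_pos.2 hdd
  have hr2 : √(mink d d) ^ 2 = mink d d := Real.sq_sqrt hdd.le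
  refine ⟨(√(mink d d))⁻¹ • d, √(mink d d), s, hr, ?_, ?_, ?_, ?_, ?_⟩
  · have h1 : mink d d = mink I I + s ^ 2 * (-mink w w) := by
      have : mink d d = mink I d := by
        conv_lhs => rw [hd, mink_sub_left, ← hd, mink_smul_left, hwd]
        ring
      rw [this, hd, mink_sub_right, mink_smul_right, mink_comm I w, ← hsw]; ring
    have h2 : √(-mink w w) ^ 2 = -mink w w := Real.sq_sqrt (by linarith)
    apply lt_of_pow_lt_pow_left₀ 2 (by positivity)
    rw [mul_pow, h2, hr2]; linarith
  · rw [smul_smul, mul_inv_cancel₀ hr.ne', one_smul, hd]; abel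
  · rw [mink_smul_left, mink_smul_right]
    field_simp
    exact hr2.symm
  · rw [mink_smul_right, hwd, mul_zero]
  · have hnd : mink n d = 0 := by rw [hd, mink_sub_right, mink_smul_right, hnI, hnw]; ring
    rw [mink_smul_right, hnd, mul_zero]

/-- The orthonormal frame attached to a timelike `w`, a spacelike `n ⊥ w` and two spacelike unit
vectors `u`, `v` orthogonal to both, at angle `2α`. -/
def bisectorFrame (w n u v : Fin 4 → ℝ) (W N α : ℝ) : Fin 4 → Fin 4 → ℝ :=
  ![W⁻¹ • w, (2 * cos α)⁻¹ • (u + v), (2 * sin α)⁻¹ • (v - u), (-N⁻¹) • n]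

lemma isLorentzFrame_bisectorFrame {w n u v : Fin 4 → ℝ} {W N α : ℝ} (hW : 0 < W) (hN : 0 < N)
    (hcos : 0 < cos α) (hsin : 0 < sin α) (hW2 : mink w w = -W ^ 2) (hN2 : mink n n = N ^ 2)
    (hwn : mink w n = 0) (huu : mink u u = 1) (hvv : mink v v = 1)
    (huv : mink u v = 2 * cos α ^ 2 - 1)
    (hwu : mink w u = 0) (hwv : mink w v = 0) (hun : mink u n = 0) (hvn : mink v n = 0) :
    IsLorentzFrame (bisectorFrame w n u v W N α) := by
  have hvu : mink v u = 2 * cos α ^ 2 - 1 := by rw [mink_comm, huv]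
  have hsc := Real.sin_sq_add_cos_sq α
  constructor <;>
    simp only [bisectorFrame, Matrix.cons_val, mink_smul_left, mink_smul_right, mink_add_left,
      mink_add_right, mink_sub_left, mink_sub_right, hW2, hN2, huu, hvv, hvu, huv, hwu, hwv, hun,
      hvn, hwn]
  · field_simp
  · field_simp; ring
  · field_simp; linarith
  · field_simp
  all_goals ring

lemma exists_frame_of_foot {w n I J Q : Fin 4 → ℝ}
    (hww : mink w w < 0) (hnn : 0 < mink n n) (hwn : mink w n = 0)
    (hnI : mink n I = 0) (hnJ : mink n J = 0) (hII : mink I I < 0) (hJJ : mink J J < 0)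
    (hQQ : mink Q Q < 0)
    (hwI : mink w I < 0) (hwJ : mink w J < 0) {c : ℝ} (hc : 0 < c) (hQ : Q = w - c • n)
    (hind : ∀ x y z : ℝ, x • I + y • J + z • w = 0 → x = 0 ∧ y = 0) :
    ∃ α ∈ Set.Ioo 0 (π / 2), ∃ e, IsLorentzFrame e ∧ w ∈ frameCone e α ∧
      I ∈ frameCone e α ∧ J ∈ frameCone e α ∧ Q ∈ frameCone e α := by
  have hnw : mink n w = 0 := by rw [mink_comm]; exact hwn
  obtain ⟨u, r, s, hr, hrs, hI, huu, hwu, hnu⟩ := exists_unit_component hww hnw hnI hII hwI (by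
    intro z hz
    have := (hind 1 0 (-z) (by rw [hz]; module)).1
    norm_num at this)
  obtain ⟨v, r', s', hr', hrs', hJ, hvv, hwv, hnv⟩ := exists_unit_component hww hnw hnJ hJJ hwJ (by
    intro z hz
    have := (hind 0 1 (-z) (by rw [hz]; module)).2
    norm_num at this)
  have hplus : 0 < mink (u + v) (u + v) := by
    refine mink_self_pos_of_orthogonal hww (by rw [mink_add_right, hwu, hwv, add_zero]) ?_
    intro h0
    have := (hind r' r (-(r' * s + r * s')) (by
      have : v = -u := by rw [add_comm] at h0; exact eq_neg_of_add_eq_zero_left h0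
      rw [hI, hJ, this]; module)).1
    exact hr'.ne' this
  have hminus : 0 < mink (v - u) (v - u) := by
    refine mink_self_pos_of_orthogonal hww (by rw [mink_sub_right, hwu, hwv, sub_zero]) ?_
    intro h0
    have := (hind r' (-r) (-(r' * s - r * s')) (by
      have : v = u := sub_eq_zero.1 h0
      rw [hI, hJ, this]; module)).1
    exact hr'.ne' this
  set k := mink u v with hk
  have hvu : mink v u = k := by rw [mink_comm]
  have hp2 : mink (u + v) (u + v) = 2 + 2 * k := by
    simp only [mink_add_left, mink_add_right, huu, hvv, hvu, ← hk]; ring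
  have hm2 : mink (v - u) (v - u) = 2 - 2 * k := by
    simp only [mink_sub_left, mink_sub_right, huu, hvv, hvu, ← hk]; ring
  rw [hp2] at hplus
  rw [hm2] at hminus
  have hk1 : -1 < k := by linarith
  have hk2 : k < 1 := by linarith
  set α := arccos k / 2 with hα
  have hα0 : 0 < α := by have := Real.arccos_pos.2 hk2; positivity
  have hα2 : α < π / 2 := by
    have : arccos k < π := by
      rcases (Real.arccos_le_pi k).lt_or_eq with h | h
      · exact h
      · rw [Real.arccos_eq_pi] at h; linarith
    rw [hα]; linarith
  have hcos : 0 < cos α := Real.cos_pos_of_mem_Ioo ⟨by linarith, hα2⟩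
  have hsin : 0 < sin α := Real.sin_pos_of_pos_of_lt_pi hα0 (by linarith)
  have hck : k = 2 * cos α ^ 2 - 1 := by
    rw [← Real.cos_two_mul, hα, mul_div_cancel₀ _ (two_ne_zero), Real.cos_arccos hk1.le hk2.le]
  have hks : k = 1 - 2 * sin α ^ 2 := by linarith [Real.sin_sq_add_cos_sq α]
  set W := √(-mink w w) with hW
  have hWpos : 0 < W := Real.sqrt_pos.2 (by linarith)
  have hW2 : mink w w = -W ^ 2 := by rw [hW, Real.sq_sqrt (by linarith)]; ring
  set N := √(mink n n) with hN
  have hNpos : 0 < N := Real.sqrt_pos.2 hnn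
  have hN2 : mink n n = N ^ 2 := by rw [hN, Real.sq_sqrt hnn.le]
  have huw : mink u w = 0 := by rw [mink_comm]; exact hwu
  have hvw : mink v w = 0 := by rw [mink_comm]; exact hwv
  have hun : mink u n = 0 := by rw [mink_comm]; exact hnu
  have hvn : mink v n = 0 := by rw [mink_comm]; exact hnv
  have hQc : c * N < W := by
    rw [hQ] at hQQ
    simp only [mink_sub_left, mink_sub_right, mink_smul_left, mink_smul_right, hwn, hnw, hW2,
      hN2] at hQQ
    apply lt_of_pow_lt_pow_left₀ 2 (by positivity)
    nlinarith
  refine ⟨α, ⟨hα0, hα2⟩, bisectorFrame w n u v W N α, ?_, ?_, ?_, ?_, ?_⟩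
  · exact isLorentzFrame_bisectorFrame hWpos hNpos hcos hsin hW2 hN2 hwn huu hvv
      (hk.symm.trans hck) hwu hwv hun hvn
  · simp only [frameCone, bisectorFrame, Set.mem_ofPred_eq, Matrix.cons_val, mink_smul_left,
      mink_add_left,
      mink_sub_left, hW2, huw, hvw, hnw]
    field_simp
    refine ⟨?_, ?_, ?_, ?_, ?_⟩ <;> norm_num <;> positivity
  · rw [hI]
    simp only [frameCone, bisectorFrame, Set.mem_ofPred_eq, Matrix.cons_val, mink_smul_left,
      mink_add_left,
      mink_sub_left, mink_smul_right, mink_add_right, hW2, huw, hvw, hnw, huu, hwu, hvu, hnu]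
    have e1 : (2 * cos α)⁻¹ * (r * 1 + s * 0 + (r * k + s * 0)) = r * cos α := by
      rw [hck]; field_simp; ring
    have e2 : (2 * sin α)⁻¹ * (r * k + s * 0 - (r * 1 + s * 0)) = -(r * sin α) := by
      rw [hks]; field_simp; ring
    have e3 : -(W⁻¹ * (r * 0 + s * -W ^ 2)) - -N⁻¹ * (r * 0 + s * 0) = s * W := by
      field_simp; ring
    rw [e1, e2, e3]
    refine ⟨by linarith, by simp, ?_, ?_, ?_⟩
    · rw [mul_comm]; exact mul_le_mul_of_nonneg_left hrs.le hcos.le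
    · have := mul_pos hr (mul_pos hsin hcos)
      linarith
    · have := mul_pos hr (mul_pos hsin hcos)
      linarith
  · rw [hJ]
    simp only [frameCone, bisectorFrame, Set.mem_ofPred_eq, Matrix.cons_val, mink_smul_left,
      mink_add_left,
      mink_sub_left, mink_smul_right, mink_add_right, hW2, huw, hvw, hnw, hvv, hwv, ← hk, hnv]
    have e1 : (2 * cos α)⁻¹ * (r' * k + s' * 0 + (r' * 1 + s' * 0)) = r' * cos α := by
      rw [hck]; field_simp; ring
    have e2 : (2 * sin α)⁻¹ * (r' * 1 + s' * 0 - (r' * k + s' * 0)) = r' * sin α := by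
      rw [hks]; field_simp; ring
    have e3 : -(W⁻¹ * (r' * 0 + s' * -W ^ 2)) - -N⁻¹ * (r' * 0 + s' * 0) = s' * W := by
      field_simp; ring
    rw [e1, e2, e3]
    refine ⟨by linarith, by simp, ?_, ?_, ?_⟩
    · rw [mul_comm]; exact mul_le_mul_of_nonneg_left hrs'.le hcos.le
    · have := mul_pos hr' (mul_pos hsin hcos)
      linarith
    · have := mul_pos hr' (mul_pos hsin hcos)
      linarith
  · rw [hQ]
    simp only [frameCone, bisectorFrame, Set.mem_ofPred_eq, Matrix.cons_val, mink_smul_left,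
      mink_add_left,
      mink_sub_left, mink_smul_right, mink_sub_right, hW2, huw, hvw, hnw, hwn, hun, hvn, hN2]
    have e3 : -(W⁻¹ * (-W ^ 2 - c * 0)) - -N⁻¹ * (0 - c * N ^ 2) = W - c * N := by
      field_simp; ring
    have e4 : -N⁻¹ * (0 - c * N ^ 2) = c * N := by field_simp; ring
    rw [e3, e4]
    refine ⟨by linarith, by positivity, ?_, by simp, by simp⟩
    simp only [mul_zero, sub_zero, add_zero]
    exact mul_nonneg hcos.le (by linarith)

lemma linearIndependent_kleinLift (Δ : GeodesicSimplex3) :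
    LinearIndependent ℝ fun a => kleinLift (Δ.v a) := by
  rw [Fintype.linearIndependent_iff]
  intro g hg i
  refine affineIndependent_iff.1 Δ.indep Finset.univ g ?_ ?_ i (Finset.mem_univ i)
  · have := congrFun hg 0
    simpa [kleinLift] using this
  · ext j
    have h1 := congrFun hg 1
    have h2 := congrFun hg 2
    have h3 := congrFun hg 3
    simp only [Fin.sum_univ_four, kleinLift] at h1 h2 h3
    fin_cases j <;> simp [Fin.sum_univ_four] <;> simp at h1 h2 h3 <;> assumption

lemma outwardNormal_spec (Δ : GeodesicSimplex3) (k : Fin 4) :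
    (∀ a, a ≠ k → mink (outwardNormal Δ k) (kleinLift (Δ.v a)) = 0) ∧
      mink (outwardNormal Δ k) (kleinLift (Δ.v k)) < 0 ∧
      0 < mink (outwardNormal Δ k) (outwardNormal Δ k) := by
  refine Classical.epsilon_spec (p := fun nv : Fin 4 → ℝ =>
    (∀ a, a ≠ k → mink nv (kleinLift (Δ.v a)) = 0) ∧
      mink nv (kleinLift (Δ.v k)) < 0 ∧ 0 < mink nv nv) ?_
  let b := basisOfLinearIndependentOfCardEqFinrank (linearIndependent_kleinLift Δ) (by simp)
  have hb : ∀ a, b a = kleinLift (Δ.v a) := fun a => by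
    simp [b]
  let f := b.coord k
  let n : Fin 4 → ℝ := ![f (Pi.single 0 1), -f (Pi.single 1 1), -f (Pi.single 2 1),
    -f (Pi.single 3 1)]
  have hn : ∀ x, mink n x = -f x := by
    intro x
    have hx : x = x 0 • Pi.single 0 1 + x 1 • Pi.single 1 1 + x 2 • Pi.single 2 1 +
        x 3 • (Pi.single 3 1 : Fin 4 → ℝ) := by
      ext i; fin_cases i <;> simp
    conv_rhs => rw [hx]
    simp only [map_add, map_smul, smul_eq_mul, mink, n]
    simp
    ring
  have hn0 : ∀ a, a ≠ k → mink n (kleinLift (Δ.v a)) = 0 := by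
    intro a ha
    rw [hn, ← hb]
    simp [f, ha]
  have hnk : mink n (kleinLift (Δ.v k)) = -1 := by
    rw [hn, ← hb]
    simp [f]
  refine ⟨n, hn0, by rw [hnk]; norm_num, ?_⟩
  obtain ⟨a, ha⟩ := exists_ne k
  refine mink_self_pos_of_orthogonal (mink_kleinLift_neg (Δ.mem_ball a) (Δ.mem_ball a))
    (by rw [mink_comm]; exact hn0 a ha) ?_
  rintro h0
  rw [h0] at hnk
  simp [mink] at hnk

lemma mink_outwardNormal_nonneg {Δ : GeodesicSimplex3} {k l : Fin 4}
    (h : π / 2 ≤ dihedralAngleFaces Δ k l) :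
    0 ≤ mink (outwardNormal Δ k) (outwardNormal Δ l) := by
  have hk := (outwardNormal_spec Δ k).2.2
  have hl := (outwardNormal_spec Δ l).2.2
  rw [dihedralAngleFaces, Real.arccos] at h
  have h1 := Real.arcsin_nonpos.1 (by linarith : arcsin _ ≤ 0)
  rw [div_le_iff₀ (by positivity)] at h1
  linarith

/-- The vertices of a 2-obtuse simplex lie in a frame cone of half-angle `α`, whose apex is the
orthogonal projection of the vertex `q` to the opposite face plane. -/
lemma exists_frameCone_of_obtuse (Δ : GeodesicSimplex3) {p i j q : Fin 4} (hij : i ≠ j)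
    (hpi : p ≠ i) (hpj : p ≠ j) (hqp : q ≠ p) (hqi : q ≠ i) (hqj : q ≠ j)
    (hi : 0 ≤ mink (outwardNormal Δ i) (outwardNormal Δ q))
    (hj : 0 ≤ mink (outwardNormal Δ j) (outwardNormal Δ q)) :
    ∃ α ∈ Set.Ioo 0 (π / 2), ∃ e, IsLorentzFrame e ∧
      ∀ a, kleinLift (Δ.v a) ∈ frameCone e α := by
  have hneg : ∀ a b, mink (kleinLift (Δ.v a)) (kleinLift (Δ.v b)) < 0 := fun a b =>
    mink_kleinLift_neg (Δ.mem_ball a) (Δ.mem_ball b)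
  have hcover : ∀ a, a = p ∨ a = i ∨ a = j ∨ a = q := by
    clear hi hj hneg
    revert p i j q
    decide
  obtain ⟨hn0, hnq, hnn⟩ := outwardNormal_spec Δ q
  obtain ⟨hi0, hii, -⟩ := outwardNormal_spec Δ i
  obtain ⟨hj0, hjj, -⟩ := outwardNormal_spec Δ j
  obtain ⟨hp0, hpp, -⟩ := outwardNormal_spec Δ p
  set n := outwardNormal Δ q
  set Ni := outwardNormal Δ i
  set Nj := outwardNormal Δ j
  set Np := outwardNormal Δ p
  have hn_p := hn0 p hqp.symm
  have hn_i := hn0 i hqi.symm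
  have hn_j := hn0 j hqj.symm
  have hi_p := hi0 p hpi
  have hi_j := hi0 j hij.symm
  have hi_q := hi0 q hqi
  have hj_p := hj0 p hpj
  have hj_i := hj0 i hij
  have hj_q := hj0 q hqj
  have hp_i := hp0 i hpi.symm
  have hp_j := hp0 j hpj.symm
  have hpq := hneg p q
  have hiq := hneg i q
  have hjq := hneg j q
  have hqp' := hneg q p
  have hqi' := hneg q i
  have hqj' := hneg q j
  have hqq := hneg q q
  have hspan : Submodule.span ℝ (Set.range fun a => kleinLift (Δ.v a)) = ⊤ :=
    (linearIndependent_kleinLift Δ).span_eq_top_of_card_eq_finrank (by simp)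
  have hII := hneg i i
  have hJJ := hneg j j
  set P := kleinLift (Δ.v p) with hP
  set I := kleinLift (Δ.v i) with hI
  set J := kleinLift (Δ.v j) with hJ
  set Q := kleinLift (Δ.v q) with hQ
  set c := -mink n Q / mink n n with hc
  have hcpos : 0 < c := div_pos (by linarith) hnn
  have hcn : c * mink n n = -mink n Q := div_mul_cancel₀ _ hnn.ne'
  set w := Q + c • n with hw
  have hQn : mink Q n = mink n Q := mink_comm _ _
  have hwn : mink w n = 0 := by
    rw [hw, mink_add_left, mink_smul_left, hcn, hQn]; ring
  have hwQ : mink w Q < 0 := by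
    rw [hw, mink_add_left, mink_smul_left]
    nlinarith
  have hww : mink w w < 0 := by
    conv_lhs => rw [hw, mink_add_right, mink_smul_right, hwn]
    linarith
  obtain ⟨A, B, C, hwABC⟩ : ∃ A B C : ℝ, w = A • P + B • I + C • J := by
    obtain ⟨g, hg⟩ := (Submodule.mem_span_range_iff_exists_fun ℝ).1
      (hspan ▸ Submodule.mem_top : w ∈ Submodule.span ℝ (Set.range fun a => kleinLift (Δ.v a)))
    have hsum : ∀ f : Fin 4 → Fin 4 → ℝ, ∑ a, f a = f p + f i + f j + f q := by
      intro f
      have : (Finset.univ : Finset (Fin 4)) = {p, i, j, q} := by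
        ext a; simpa using hcover a
      rw [this, Finset.sum_insert (by simp [hpi, hpj, hqp.symm]),
        Finset.sum_insert (by simp [hij, hqi.symm]), Finset.sum_insert (by simp [hqj.symm]),
        Finset.sum_singleton]
      abel
    rw [hsum] at hg
    have hgq : g q = 0 := by
      have h1 : mink n w = 0 := by rw [mink_comm]; exact hwn
      rw [← hg] at h1
      simp only [mink_add_right, mink_smul_right, ← hP, ← hI, ← hJ, ← hQ, hn_p, hn_i, hn_j] at h1
      simpa [hnq.ne] using h1
    refine ⟨g p, g i, g j, ?_⟩
    rw [← hg, hgq]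
    simp [hP, hI, hJ]
  have hB : B ≤ 0 := by
    have h1 : 0 ≤ mink Ni w := by
      rw [hw, mink_add_right, mink_smul_right, hi_q]
      have := mul_nonneg hcpos.le hi
      linarith
    rw [hwABC, mink_add_right, mink_add_right, mink_smul_right, mink_smul_right, mink_smul_right,
      hi_p, hi_j] at h1
    nlinarith
  have hC : C ≤ 0 := by
    have h1 : 0 ≤ mink Nj w := by
      rw [hw, mink_add_right, mink_smul_right, hj_q]
      have := mul_nonneg hcpos.le hj
      linarith
    rw [hwABC, mink_add_right, mink_add_right, mink_smul_right, mink_smul_right, mink_smul_right,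
      hj_p, hj_i] at h1
    nlinarith
  have hA : 0 < A := by
    rw [hwABC, mink_add_left, mink_add_left, mink_smul_left, mink_smul_left, mink_smul_left] at hwQ
    by_contra hA
    have h1 := mul_nonneg_of_nonpos_of_nonpos (not_lt.1 hA) hpq.le
    have h2 := mul_nonneg_of_nonpos_of_nonpos hB hiq.le
    have h3 := mul_nonneg_of_nonpos_of_nonpos hC hjq.le
    linarith
  obtain ⟨α, hα, e, he, hwe, hIe, hJe, hQe⟩ := exists_frame_of_foot (w := w) (n := n) (I := I)
    (J := J) (Q := Q) hww hnn hwn hn_i hn_j hII hJJ hqq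
    (by rw [hw, mink_add_left, mink_smul_left, hn_i]; linarith)
    (by rw [hw, mink_add_left, mink_smul_left, hn_j]; linarith) hcpos (by rw [hw]; abel) (by
      intro x y z hxyz
      have hz : z = 0 := by
        have h1 : mink Np (x • I + y • J + z • w) = 0 := by rw [hxyz]; simp [mink]
        simp only [hwABC, mink_add_right, mink_smul_right, hp_i, hp_j] at h1
        simpa [hA.ne', hpp.ne] using h1
      subst hz
      constructor
      · have h1 : mink Ni (x • I + y • J + (0 : ℝ) • w) = 0 := by rw [hxyz]; simp [mink]
        simp only [mink_add_right, mink_smul_right, hi_j] at h1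
        simpa [hii.ne] using h1
      · have h1 : mink Nj (x • I + y • J + (0 : ℝ) • w) = 0 := by rw [hxyz]; simp [mink]
        simp only [mink_add_right, mink_smul_right, hj_i] at h1
        simpa [hjj.ne] using h1)
  refine ⟨α, hα, e, he, ?_⟩
  have hPe : P ∈ frameCone e α := by
    have hadd : ∀ {b : ℝ} {x y : Fin 4 → ℝ}, b ≤ 0 → x ∈ frameCone e α → y ∈ frameCone e α →
        x + (-b) • y ∈ frameCone e α := by
      intro b x y hb hx hy
      rcases hb.lt_or_eq with hb | rfl
      · exact frameCone_add hx (frameCone_smul (neg_pos.2 hb) hy)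
      · simpa using hx
    have hPw : P = A⁻¹ • (w + (-B) • I + (-C) • J) := by
      rw [eq_inv_smul_iff₀ hA.ne', hwABC]; module
    rw [hPw]
    exact frameCone_smul (inv_pos.2 hA) (hadd hC (hadd hB hwe hIe) hJe)
  intro a
  rcases hcover a with rfl | rfl | rfl | rfl <;> assumption

lemma exists_frameCone (Δ : GeodesicSimplex3)
    (h : ∃ p i j : Fin 4, i ≠ j ∧ p ≠ i ∧ p ≠ j ∧
      SubtendsNonacute Δ p i ∧ SubtendsNonacute Δ p j) :
    ∃ α ∈ Set.Ioo 0 (π / 2), ∃ e, IsLorentzFrame e ∧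
      ∀ a, kleinLift (Δ.v a) ∈ frameCone e α := by
  obtain ⟨p, i, j, hij, hpi, hpj, ⟨k, l, hkl, hα⟩, ⟨k', l', hkl', hβ⟩⟩ := h
  have h1 := mink_outwardNormal_nonneg hα
  have h2 := mink_outwardNormal_nonneg hβ
  obtain ⟨q, hqp, hqi, hqj⟩ : ∃ q : Fin 4, q ≠ p ∧ q ≠ i ∧ q ≠ j := by
    clear hα hβ h1 h2 hkl hkl' hij hpi hpj
    revert p i j
    decide
  have hcompl : ∀ {i j k l : Fin 4}, i ≠ j → p ≠ j → q ≠ p → q ≠ i → q ≠ j →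
      ({p, i, k, l} : Finset (Fin 4)) = Finset.univ → k = j ∧ l = q ∨ k = q ∧ l = j := by
    intro i j k l hij hpj hqp hqi hqj hkl
    have h1 : j ∈ ({p, i, k, l} : Finset (Fin 4)) := hkl ▸ Finset.mem_univ j
    have h2 : q ∈ ({p, i, k, l} : Finset (Fin 4)) := hkl ▸ Finset.mem_univ q
    simp only [Finset.mem_insert, Finset.mem_singleton] at h1 h2
    grind
  have c1 := hcompl hij hpj hqp hqi hqj hkl
  have c2 := hcompl hij.symm hpi hqp hqj hqi hkl'
  refine exists_frameCone_of_obtuse Δ hij hpi hpj hqp hqi hqj ?_ ?_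
  · rcases c2 with ⟨rfl, rfl⟩ | ⟨rfl, rfl⟩
    · exact h2
    · rw [mink_comm]; exact h2
  · rcases c1 with ⟨rfl, rfl⟩ | ⟨rfl, rfl⟩
    · exact h1
    · rw [mink_comm]; exact h1

/-- The linear coordinates `(x₀ - x₃, x₃, x₁, x₂)` with respect to a Lorentz frame `e`. -/
def frameCoord (e : Fin 4 → Fin 4 → ℝ) : (Fin 4 → ℝ) →ₗ[ℝ] (Fin 4 → ℝ) where
  toFun x := ![-mink (e 0) x - mink (e 3) x, mink (e 3) x, mink (e 1) x, mink (e 2) x]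
  map_add' x y := by
    ext i; fin_cases i <;> simp [mink_add_right]; ring
  map_smul' c x := by
    ext i; fin_cases i <;> simp [mink_smul_right]; ring

/-- The Gram matrix of the Minkowski form in the standard basis. -/
def minkMatrix : Matrix (Fin 4) (Fin 4) ℝ := Matrix.diagonal ![-1, 1, 1, 1]

lemma mink_eq_dotProduct (x y : Fin 4 → ℝ) : mink x y = x ⬝ᵥ minkMatrix.mulVec y := by
  simp [mink, minkMatrix, dotProduct, Matrix.mulVec_diagonal, Fin.sum_univ_four]

lemma minkMatrix_mul_self : minkMatrix * minkMatrix = 1 := by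
  rw [minkMatrix, Matrix.diagonal_mul_diagonal, ← Matrix.diagonal_one]
  congr 1
  ext i; fin_cases i <;> simp

lemma IsLorentzFrame.mul_mul_transpose {e : Fin 4 → Fin 4 → ℝ} (he : IsLorentzFrame e) :
    Matrix.of e * minkMatrix * (Matrix.of e).transpose = minkMatrix := by
  have key : ∀ a b, (Matrix.of e * minkMatrix * (Matrix.of e).transpose) a b =
      mink (e a) (e b) := by
    intro a b
    simp [Matrix.mul_apply, minkMatrix, Matrix.diagonal_apply, Fin.sum_univ_four, mink]
  have hc := fun a b => mink_comm (e a) (e b)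
  ext a b
  rw [key]
  fin_cases a <;> fin_cases b <;>
    simp [minkMatrix, he.e00, he.e11, he.e22, he.e33, he.e01, he.e02,
      he.e03, he.e12, he.e13, he.e23, hc 1 0, hc 2 0, hc 3 0, hc 2 1, hc 3 1, hc 3 2]

lemma IsLorentzFrame.transpose_mul_mul {e : Fin 4 → Fin 4 → ℝ} (he : IsLorentzFrame e) :
    (Matrix.of e).transpose * minkMatrix * Matrix.of e = minkMatrix := by
  have h1 : (Matrix.of e * minkMatrix) * ((Matrix.of e).transpose * minkMatrix) = 1 := by
    rw [← mul_assoc, he.mul_mul_transpose, minkMatrix_mul_self]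
  have h2 := _root_.mul_eq_one_comm.1 h1
  calc (Matrix.of e).transpose * minkMatrix * Matrix.of e
      = ((Matrix.of e).transpose * minkMatrix) * (Matrix.of e * minkMatrix) * minkMatrix := by
        simp only [mul_assoc, minkMatrix_mul_self, mul_one]
    _ = minkMatrix := by rw [h2, one_mul]

lemma IsLorentzFrame.mink_self_eq {e : Fin 4 → Fin 4 → ℝ} (he : IsLorentzFrame e)
    (x : Fin 4 → ℝ) : mink x x =
      -(mink (e 0) x) ^ 2 + (mink (e 1) x) ^ 2 + (mink (e 2) x) ^ 2 + (mink (e 3) x) ^ 2 := by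
  set y := minkMatrix.mulVec x with hy
  have hyx : minkMatrix.mulVec y = x := by
    rw [hy, Matrix.mulVec_mulVec, minkMatrix_mul_self, Matrix.one_mulVec]
  have hex : ∀ a, mink (e a) x = ((Matrix.of e).mulVec y) a := by
    intro a; rw [mink_eq_dotProduct]; rfl
  have h1 : mink x x = ((Matrix.of e).mulVec y) ⬝ᵥ
      minkMatrix.mulVec ((Matrix.of e).mulVec y) := by
    have h2 := Matrix.dotProduct_mulVec y (Matrix.of e).transpose
      (minkMatrix.mulVec ((Matrix.of e).mulVec y))
    rw [Matrix.vecMul_transpose] at h2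
    rw [← h2, Matrix.mulVec_mulVec, Matrix.mulVec_mulVec, he.transpose_mul_mul, hyx,
      mink_eq_dotProduct, dotProduct_comm]
  rw [h1, ← mink_eq_dotProduct, hex, hex, hex, hex]
  simp only [mink]
  ring

lemma IsLorentzFrame.abs_det_frameCoord {e : Fin 4 → Fin 4 → ℝ} (he : IsLorentzFrame e) :
    |LinearMap.det (frameCoord e)| = 1 := by
  let S : Matrix (Fin 4) (Fin 4) ℝ := !![-1, 0, 0, -1; 0, 0, 0, 1; 0, 1, 0, 0; 0, 0, 1, 0]
  have hJ : minkMatrix.det = -1 := by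
    simp [minkMatrix, Matrix.det_diagonal, Fin.prod_univ_four]
  have hS : S.det = -1 := by
    simp [S, Matrix.det_succ_row_zero, Fin.sum_univ_succ, Fin.succAbove]
  have hE : (Matrix.of e).det ^ 2 = 1 := by
    have := congrArg Matrix.det he.mul_mul_transpose
    rw [Matrix.det_mul, Matrix.det_mul, Matrix.det_transpose, hJ] at this
    linarith
  have hM : frameCoord e = Matrix.toLin' (S * (Matrix.of e * minkMatrix)) := by
    refine LinearMap.ext fun x => ?_
    have hex : ∀ a, mink (e a) x = ((Matrix.of e).mulVec (minkMatrix.mulVec x)) a := by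
      intro a; rw [mink_eq_dotProduct]; rfl
    rw [Matrix.toLin'_apply, ← Matrix.mulVec_mulVec, ← Matrix.mulVec_mulVec]
    ext i
    fin_cases i
    · simp [frameCoord, hex, S, Matrix.mulVec, dotProduct, Fin.sum_univ_four]; ring
    all_goals simp [frameCoord, hex, S, Matrix.mulVec, dotProduct, Fin.sum_univ_four]
  rw [hM, LinearMap.det_toLin', Matrix.det_mul, Matrix.det_mul, hS, hJ]
  rw [show (-1 : ℝ) * ((Matrix.of e).det * -1) = (Matrix.of e).det by ring]
  rw [← sq_eq_sq₀ (abs_nonneg _) zero_le_one, sq_abs, hE, one_pow]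

open MeasureTheory ENNReal in
lemma lintegral_cube_Ioi_indicator {G : ℝ} (hG : 0 < G) :
    ∫⁻ t in Set.Ioi (0 : ℝ), ENNReal.ofReal (t ^ 3) * Set.indicator {t : ℝ | t ^ 2 * G < 1} 1 t =
      ENNReal.ofReal ((G ^ 2)⁻¹) / 4 := by
  have hset : ∀ t ∈ Set.Ioi (0 : ℝ), t ^ 2 * G < 1 ↔ t < (√G)⁻¹ := by
    intro t ht
    have hs := Real.sqrt_pos.2 hG
    rw [lt_inv_comm₀ ht hs, Real.sqrt_lt' (inv_pos.2 ht), inv_pow, lt_inv_comm₀ hG (pow_pos ht 2),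
      ← one_div, lt_div_iff₀ hG]
  have hb : 0 ≤ (√G)⁻¹ := by positivity
  calc _ = ∫⁻ t in Set.Ioo 0 (√G)⁻¹, ENNReal.ofReal (t ^ 3) := by
        rw [← lintegral_indicator measurableSet_Ioi, ← lintegral_indicator measurableSet_Ioo]
        congr 1
        ext t
        by_cases ht : t ∈ Set.Ioi (0 : ℝ)
        · have := hset t ht
          by_cases h2 : t < (√G)⁻¹
          · simp [Set.indicator, this, h2, Set.mem_Ioi.1 ht]
          · simp [Set.indicator, this, h2, Set.mem_Ioi.1 ht]
        · have h1 : ¬ 0 < t := ht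
          simp [Set.indicator, h1]
    _ = ENNReal.ofReal (∫ t in (0 : ℝ)..(√G)⁻¹, t ^ 3) := by
        rw [intervalIntegral.integral_of_le hb, integral_Ioc_eq_integral_Ioo,
          ofReal_integral_eq_lintegral_ofReal]
        · exact ((by fun_prop : Continuous fun t : ℝ => t ^ 3).integrableOn_Icc).mono_set
            Set.Ioo_subset_Icc_self
        · filter_upwards [ae_restrict_mem measurableSet_Ioo] with t ht
          exact pow_nonneg ht.1.le 3
    _ = _ := by
        rw [integral_pow]
        have h4 : √G ^ 4 = G ^ 2 := by
          rw [show √G ^ 4 = (√G ^ 2) ^ 2 by ring, Real.sq_sqrt hG.le]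
        have : (((√G)⁻¹ ^ (3 + 1) - 0 ^ (3 + 1)) / ((3 : ℕ) + 1) : ℝ) = (G ^ 2)⁻¹ / 4 := by
          rw [inv_pow]; norm_num [h4]
        rw [this, ENNReal.ofReal_div_of_pos (by norm_num)]
        norm_num

open MeasureTheory ENNReal Pointwise in
/-- Lebesgue measure of the part `{G < 1}` of the cone over `s`, where `G` is the 2-homogeneous
extension of `g`. -/
lemma volume_cone {s : Set (Fin 3 → ℝ)} (hs : MeasurableSet s) {g : (Fin 3 → ℝ) → ℝ}
    (hg : Measurable g) (hpos : ∀ p ∈ s, 0 < g p) :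
    volume {x : Fin 4 → ℝ | 0 < x 0 ∧ (x 0)⁻¹ • Fin.tail x ∈ s ∧
      x 0 ^ 2 * g ((x 0)⁻¹ • Fin.tail x) < 1} = (∫⁻ p in s, ENNReal.ofReal ((g p ^ 2)⁻¹)) / 4 := by
  let D : Set (ℝ × (Fin 3 → ℝ)) := {x | 0 < x.1 ∧ x.1⁻¹ • x.2 ∈ s ∧ x.1 ^ 2 * g (x.1⁻¹ • x.2) < 1}
  have hm : Measurable fun x : ℝ × (Fin 3 → ℝ) => x.1⁻¹ • x.2 := by fun_prop
  have hD : MeasurableSet D := by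
    refine (measurableSet_lt measurable_const measurable_fst).inter ((hm hs).inter ?_)
    exact measurableSet_lt ((measurable_fst.pow_const 2).mul (hg.comp hm)) measurable_const
  let E : Set (ℝ × (Fin 3 → ℝ)) := {x | x.2 ∈ s ∧ x.1 ^ 2 * g x.2 < 1}
  have hE : MeasurableSet E := (measurable_snd hs).inter
    (measurableSet_lt ((measurable_fst.pow_const 2).mul (hg.comp measurable_snd)) measurable_const)
  have hpre : {x : Fin 4 → ℝ | 0 < x 0 ∧ (x 0)⁻¹ • Fin.tail x ∈ s ∧
      x 0 ^ 2 * g ((x 0)⁻¹ • Fin.tail x) < 1} =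
      MeasurableEquiv.piFinSuccAbove (fun _ : Fin 4 => ℝ) 0 ⁻¹' D := by
    ext x
    rfl
  rw [hpre, (volume_preserving_piFinSuccAbove (fun _ : Fin 4 => ℝ) 0).measure_preimage
    hD.nullMeasurableSet, Measure.volume_eq_prod, Measure.prod_apply hD]
  have hslice : ∀ t : ℝ, volume (Prod.mk t ⁻¹' D) = Set.indicator (Set.Ioi 0)
      (fun t => ENNReal.ofReal (t ^ 3) * volume (Prod.mk t ⁻¹' E)) t := by
    intro t
    by_cases ht : 0 < t
    · have : Prod.mk t ⁻¹' D = t • (Prod.mk t ⁻¹' E) := by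
        ext y
        rw [Set.mem_smul_set_iff_inv_smul_mem₀ ht.ne']
        simp [D, E, ht]
      rw [this, Measure.addHaar_smul, Set.indicator_of_mem (Set.mem_Ioi.2 ht)]
      simp [abs_of_pos (pow_pos ht 3)]
    · have : Prod.mk t ⁻¹' D = ∅ := by
        ext y; simp [D, ht]
      rw [this, Set.indicator_of_notMem (by simpa using ht), measure_empty]
  simp_rw [hslice]
  rw [lintegral_indicator measurableSet_Ioi]
  have hmE : Measurable fun x : ℝ × (Fin 3 → ℝ) =>
      ENNReal.ofReal (x.1 ^ 3) * E.indicator 1 x :=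
    (ENNReal.measurable_ofReal.comp (measurable_fst.pow_const 3)).mul
      (measurable_one.indicator hE)
  calc ∫⁻ t in Set.Ioi (0 : ℝ), ENNReal.ofReal (t ^ 3) * volume (Prod.mk t ⁻¹' E)
      = ∫⁻ t in Set.Ioi (0 : ℝ), ∫⁻ y, ENNReal.ofReal (t ^ 3) * E.indicator 1 (t, y) := by
        congr 1
        ext t
        have hEt : MeasurableSet (Prod.mk t ⁻¹' E) := measurable_prodMk_left hE
        have hm1 : Measurable fun y => (E.indicator 1 (t, y) : ℝ≥0∞) :=
          (measurable_one.indicator hE).comp measurable_prodMk_left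
        rw [lintegral_const_mul _ hm1, ← lintegral_indicator_one hEt]
        rfl
    _ = ∫⁻ y, ∫⁻ t in Set.Ioi (0 : ℝ), ENNReal.ofReal (t ^ 3) * E.indicator 1 (t, y) :=
        lintegral_lintegral_swap hmE.aemeasurable
    _ = ∫⁻ y, s.indicator (fun p => ENNReal.ofReal ((g p ^ 2)⁻¹) / 4) y := by
        congr 1
        ext y
        by_cases hy : y ∈ s
        · rw [Set.indicator_of_mem hy, ← lintegral_cube_Ioi_indicator (hpos y hy)]
          simp [E, Set.indicator, hy]
        · rw [Set.indicator_of_notMem hy]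
          simp [E, Set.indicator, hy]
    _ = _ := by
        rw [lintegral_indicator hs]
        simp_rw [div_eq_mul_inv]
        rw [lintegral_mul_const' _ _ (by simp)]

lemma intervalIntegrable_log_two_mul_sin (a b : ℝ) :
    IntervalIntegrable (fun u => log |2 * sin u|) MeasureTheory.volume a b := by
  have h : IntervalIntegrable (fun u => log 2 + log (sin u)) MeasureTheory.volume a b :=
    intervalIntegrable_const.add intervalIntegrable_log_sin
  refine h.congr_ae ?_
  refine Filter.Eventually.filter_mono
    (MeasureTheory.ae_mono MeasureTheory.Measure.restrict_le_self) ?_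
  have hc : ({u : ℝ | sin u = 0}).Countable := by
    refine (Set.countable_range fun n : ℤ => (n : ℝ) * π).mono ?_
    intro u hu
    exact (Real.sin_eq_zero_iff.1 hu)
  filter_upwards [hc.ae_notMem MeasureTheory.volume] with u hu
  have hu' : sin u ≠ 0 := hu
  rw [Real.log_abs, Real.log_mul two_ne_zero hu']

lemma continuous_lobachevsky : Continuous lobachevsky :=
  (intervalIntegral.continuous_primitive intervalIntegrable_log_two_mul_sin 0).neg

lemma hasDerivAt_lobachevsky {θ : ℝ} (h : sin θ ≠ 0) :
    HasDerivAt lobachevsky (-log |2 * sin θ|) θ := by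
  have hne : |2 * sin θ| ≠ 0 := abs_ne_zero.2 (mul_ne_zero two_ne_zero h)
  refine (intervalIntegral.integral_hasDerivAt_right (intervalIntegrable_log_two_mul_sin 0 θ)
    ?_ ?_).neg
  · exact (Measurable.stronglyMeasurable (by fun_prop)).stronglyMeasurableAtFilter
  · exact ContinuousAt.log (by fun_prop) hne

lemma integral_log_two_mul_sin (a b : ℝ) :
    ∫ u in a..b, log |2 * sin u| = lobachevsky a - lobachevsky b := by
  rw [lobachevsky, lobachevsky, ← intervalIntegral.integral_interval_sub_left
    (intervalIntegrable_log_two_mul_sin 0 b) (intervalIntegrable_log_two_mul_sin 0 a)]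
  ring

lemma lobachevsky_pi : lobachevsky π = 0 := by
  have h : ∫ u in (0:ℝ)..π, log |2 * sin u| = ∫ u in (0:ℝ)..π, (log 2 + log (sin u)) := by
    refine intervalIntegral.integral_congr_ae_restrict ?_
    rw [Set.uIoc_of_le Real.pi_pos.le, ← MeasureTheory.restrict_Ioo_eq_restrict_Ioc]
    filter_upwards [MeasureTheory.ae_restrict_mem measurableSet_Ioo] with u hu
    rw [Real.log_abs, Real.log_mul two_ne_zero (Real.sin_pos_of_mem_Ioo hu).ne']
  have hi : IntervalIntegrable (fun u => log (sin u)) MeasureTheory.volume 0 π :=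
    intervalIntegrable_log_sin
  rw [lobachevsky, h, intervalIntegral.integral_add intervalIntegrable_const hi,
    integral_log_sin_zero_pi, intervalIntegral.integral_const]
  simp
  ring

lemma lobachevsky_pi_sub (θ : ℝ) : lobachevsky (π - θ) = -lobachevsky θ := by
  have h : ∫ u in θ..π, log |2 * sin u| = ∫ u in (0:ℝ)..(π - θ), log |2 * sin u| := by
    have := intervalIntegral.integral_comp_sub_left (a := θ) (b := π)
      (fun u => log |2 * sin u|) π
    simpa [Real.sin_pi_sub] using this
  rw [integral_log_two_mul_sin, lobachevsky_pi] at h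
  have h2 : lobachevsky (π - θ) = -∫ u in (0:ℝ)..(π - θ), log |2 * sin u| := rfl
  rw [h2, ← h]; ring

/-- The volume of an ideal simplex with dihedral angles `2α, π/2 - α, π/2 - α` is maximal at the
regular one. -/
lemma lobachevsky_sum_le {α : ℝ} (h0 : 0 ≤ α) (h1 : α ≤ π / 2) :
    lobachevsky (2 * α) + 2 * lobachevsky (π / 2 - α) ≤ 3 * lobachevsky (π / 3) := by
  set F : ℝ → ℝ := fun α => lobachevsky (2 * α) + 2 * lobachevsky (π / 2 - α) with hF
  have hcont : Continuous F := by
    have := continuous_lobachevsky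
    fun_prop
  have hpi := Real.pi_pos
  have hderiv : ∀ x ∈ Set.Ioo 0 (π / 2), HasDerivAt F (-2 * log (2 * sin x)) x := by
    intro x hx
    have hs : 0 < sin x := Real.sin_pos_of_pos_of_lt_pi hx.1 (by linarith [hx.2])
    have hc : 0 < cos x := Real.cos_pos_of_mem_Ioo ⟨by linarith [hx.1], hx.2⟩
    have h2 : sin (2 * x) ≠ 0 := by rw [Real.sin_two_mul]; positivity
    have h3 : sin (π / 2 - x) ≠ 0 := by rw [Real.sin_pi_div_two_sub]; positivity
    have d1 : HasDerivAt (fun x : ℝ => 2 * x) 2 x := by simpa using (hasDerivAt_id x).const_mul 2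
    have d2 : HasDerivAt (fun x : ℝ => π / 2 - x) (-1) x := by
      simpa using (hasDerivAt_id x).const_sub (π / 2)
    have := ((hasDerivAt_lobachevsky h2).comp x d1).add
      (((hasDerivAt_lobachevsky h3).comp x d2).const_mul 2)
    refine this.congr_deriv ?_
    rw [Real.sin_two_mul, Real.sin_pi_div_two_sub, Real.log_abs, Real.log_abs,
      show 2 * (2 * sin x * cos x) = (2 * sin x) * (2 * cos x) by ring,
      Real.log_mul (by positivity) (by positivity)]
    ring
  have hmax : F (π / 6) = 3 * lobachevsky (π / 3) := by
    simp only [hF]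
    rw [show 2 * (π / 6) = π / 3 by ring, show π / 2 - π / 6 = π / 3 by ring]; ring
  rw [← hmax]
  change F α ≤ F (π / 6)
  rcases le_total α (π / 6) with h | h
  · refine monotoneOn_of_deriv_nonneg (convex_Icc 0 (π / 6)) hcont.continuousOn ?_ ?_
      ⟨h0, h⟩ ⟨by positivity, le_rfl⟩ h
    · intro x hx
      rw [interior_Icc] at hx
      exact (hderiv x ⟨hx.1, by linarith [hx.2]⟩).differentiableAt.differentiableWithinAt
    · intro x hx
      rw [interior_Icc] at hx
      rw [(hderiv x ⟨hx.1, by linarith [hx.2]⟩).deriv]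
      have hs : 0 < sin x := Real.sin_pos_of_pos_of_lt_pi hx.1 (by linarith [hx.2])
      have h6 : sin x ≤ sin (π / 6) := Real.sin_le_sin_of_le_of_le_pi_div_two
        (by linarith [hx.1]) (by linarith) hx.2.le
      rw [Real.sin_pi_div_six] at h6
      have := Real.log_nonpos (by positivity : 0 ≤ 2 * sin x) (by linarith)
      linarith
  · refine antitoneOn_of_deriv_nonpos (convex_Icc (π / 6) (π / 2)) hcont.continuousOn ?_ ?_
      ⟨le_rfl, by linarith⟩ ⟨h, h1⟩ h
    · intro x hx
      rw [interior_Icc] at hx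
      exact (hderiv x ⟨by linarith [hx.1], hx.2⟩).differentiableAt.differentiableWithinAt
    · intro x hx
      rw [interior_Icc] at hx
      rw [(hderiv x ⟨by linarith [hx.1], hx.2⟩).deriv]
      have h6 : sin (π / 6) ≤ sin x := Real.sin_le_sin_of_le_of_le_pi_div_two
        (by linarith) hx.2.le hx.1.le
      rw [Real.sin_pi_div_six] at h6
      have := Real.log_nonneg (by linarith : 1 ≤ 2 * sin x)
      linarith

lemma v₃_nonneg : 0 ≤ v₃ := by
  have h := lobachevsky_sum_le le_rfl (by positivity)
  have h2 := lobachevsky_pi_sub (π / 2)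
  rw [show π - π / 2 = π / 2 by ring] at h2
  have h0 : lobachevsky 0 = 0 := by simp [lobachevsky]
  rw [v₃]
  simp only [mul_zero, sub_zero, h0] at h
  linarith

lemma integral_log_one_sub_ratio {α : ℝ} (h0 : 0 < α) (h1 : α < π / 2) :
    IntervalIntegrable (fun ψ => -log (1 - (cos α / cos ψ) ^ 2)) MeasureTheory.volume (-α) α ∧
    ∫ ψ in (-α)..α, -log (1 - (cos α / cos ψ) ^ 2) =
      2 * (lobachevsky (2 * α) + 2 * lobachevsky (π / 2 - α)) := by
  set f : ℝ → ℝ := fun ψ => -log |2 * sin (ψ + α)| - log |2 * sin (α - ψ)| +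
    2 * log |2 * sin (ψ + π / 2)| with hf
  have i1 : IntervalIntegrable (fun ψ => log |2 * sin (ψ + α)|) MeasureTheory.volume (-α) α := by
    have := (intervalIntegrable_log_two_mul_sin (-α + α) (α + α)).comp_add_right α
    simpa using this
  have i2 : IntervalIntegrable (fun ψ => log |2 * sin (α - ψ)|) MeasureTheory.volume (-α) α := by
    have := (intervalIntegrable_log_two_mul_sin (α - -α) (α - α)).comp_sub_left α
    simpa using this
  have i3 : IntervalIntegrable (fun ψ => log |2 * sin (ψ + π / 2)|)
      MeasureTheory.volume (-α) α := by
    have := (intervalIntegrable_log_two_mul_sin (-α + π / 2) (α + π / 2)).comp_add_right (π / 2)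
    simpa using this
  have i1' : IntervalIntegrable (fun ψ => -log |2 * sin (ψ + α)|) MeasureTheory.volume (-α) α :=
    i1.neg
  have i12 : IntervalIntegrable (fun ψ => -log |2 * sin (ψ + α)| - log |2 * sin (α - ψ)|)
      MeasureTheory.volume (-α) α := i1'.sub i2
  have hfi : IntervalIntegrable f MeasureTheory.volume (-α) α := i12.add (i3.const_mul 2)
  have hEq : ∀ ψ ∈ Set.Ioo (-α) α, f ψ = -log (1 - (cos α / cos ψ) ^ 2) := by
    intro ψ hψ
    have s1 : 0 < sin (ψ + α) :=
      Real.sin_pos_of_pos_of_lt_pi (by linarith [hψ.1]) (by linarith [hψ.2])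
    have s2 : 0 < sin (α - ψ) :=
      Real.sin_pos_of_pos_of_lt_pi (by linarith [hψ.2]) (by linarith [hψ.1])
    have s3 : 0 < cos ψ := Real.cos_pos_of_mem_Ioo ⟨by linarith [hψ.1], by linarith [hψ.2]⟩
    have e : 1 - (cos α / cos ψ) ^ 2 = (2 * sin (ψ + α)) * (2 * sin (α - ψ)) / (2 * cos ψ) ^ 2 := by
      rw [Real.sin_add, Real.sin_sub]
      field_simp
      linear_combination cos α ^ 2 * (Real.sin_sq_add_cos_sq ψ) -
        cos ψ ^ 2 * (Real.sin_sq_add_cos_sq α)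
    rw [e, Real.log_div (by positivity) (by positivity),
      Real.log_mul (by positivity) (by positivity),
      Real.log_pow]
    simp only [hf, Real.log_abs, Real.sin_add_pi_div_two]
    push_cast
    ring
  have hle : -α ≤ α := by linarith
  have hae : f =ᵐ[MeasureTheory.volume.restrict (Set.uIoc (-α) α)]
      fun ψ => -log (1 - (cos α / cos ψ) ^ 2) := by
    rw [Set.uIoc_of_le hle, ← MeasureTheory.restrict_Ioo_eq_restrict_Ioc]
    filter_upwards [MeasureTheory.ae_restrict_mem measurableSet_Ioo] with ψ hψ using hEq ψ hψ
  refine ⟨hfi.congr_ae hae, ?_⟩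
  rw [← intervalIntegral.integral_congr_ae_restrict hae]
  simp only [hf]
  rw [intervalIntegral.integral_add i12 (i3.const_mul 2),
    intervalIntegral.integral_sub i1' i2, intervalIntegral.integral_neg,
    intervalIntegral.integral_const_mul,
    intervalIntegral.integral_comp_add_right (fun u => log |2 * sin u|),
    intervalIntegral.integral_comp_add_right (fun u => log |2 * sin u|),
    intervalIntegral.integral_comp_sub_left (fun u => log |2 * sin u|),
    integral_log_two_mul_sin, integral_log_two_mul_sin, integral_log_two_mul_sin]
  have h0' : lobachevsky 0 = 0 := by simp [lobachevsky]
  have hs := lobachevsky_pi_sub (π / 2 - α)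
  rw [show -α + α = 0 by ring, show α - α = 0 by ring, show α - -α = 2 * α by ring,
    show α + α = 2 * α by ring, show -α + π / 2 = π / 2 - α by ring,
    show α + π / 2 = π - (π / 2 - α) by ring, hs, h0']
  ring

open MeasureTheory ENNReal in
lemma lintegral_Ioi_inv_sq_affine {c : ℝ} (hc : c < 1) :
    ∫⁻ b in Set.Ioi (0 : ℝ), ENNReal.ofReal (((1 + 2 * b - c) ^ 2)⁻¹) =
      ENNReal.ofReal (1 / 2 * (1 - c)⁻¹) := by
  have hpos : ∀ b ∈ Set.Ici (0 : ℝ), 0 < 1 + 2 * b - c := by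
    intro b hb
    have : (0 : ℝ) ≤ b := hb
    linarith
  have hd : ∀ b ∈ Set.Ici (0 : ℝ), HasDerivAt (fun b : ℝ => -(1 / 2 * (1 + 2 * b - c)⁻¹))
      (((1 + 2 * b - c) ^ 2)⁻¹) b := by
    intro b hb
    have h1 : HasDerivAt (fun b : ℝ => 1 + 2 * b - c) 2 b := by
      simpa using (((hasDerivAt_id b).const_mul 2).const_add 1).sub_const c
    refine ((h1.inv (hpos b hb).ne').const_mul (1 / 2)).neg.congr_deriv ?_
    have := (hpos b hb).ne'
    field_simp
  have hd' : ∀ b ∈ Set.Ioi (0 : ℝ), HasDerivAt (fun b : ℝ => -(1 / 2 * (1 + 2 * b - c)⁻¹))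
      (((1 + 2 * b - c) ^ 2)⁻¹) b := fun b hb => hd b (Set.mem_Ici_of_Ioi hb)
  have hcont : ContinuousWithinAt (fun b : ℝ => -(1 / 2 * (1 + 2 * b - c)⁻¹)) (Set.Ici 0) 0 :=
    (hd 0 Set.self_mem_Ici).continuousAt.continuousWithinAt
  have hlim : Filter.Tendsto (fun b : ℝ => -(1 / 2 * (1 + 2 * b - c)⁻¹)) Filter.atTop (nhds 0) := by
    have h1 : Filter.Tendsto (fun b : ℝ => 1 + 2 * b - c) Filter.atTop Filter.atTop := by
      have := Filter.tendsto_atTop_add_const_left Filter.atTop (1 - c)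
        (Filter.tendsto_id.const_mul_atTop (two_pos : (0 : ℝ) < 2))
      refine this.congr fun b => ?_
      simp only [id]; ring
    have h2 := ((tendsto_inv_atTop_zero.comp h1).const_mul (1 / 2)).neg
    rw [mul_zero, neg_zero] at h2
    exact h2
  have hnn : ∀ b ∈ Set.Ioi (0 : ℝ), 0 ≤ ((1 + 2 * b - c) ^ 2)⁻¹ := fun b _ => by positivity
  rw [← ofReal_integral_eq_lintegral_ofReal
    (integrableOn_Ioi_deriv_of_nonneg hcont hd' hnn hlim)
    (by filter_upwards [ae_restrict_mem measurableSet_Ioi] with b hb using hnn b hb),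
    integral_Ioi_of_hasDerivAt_of_nonneg hcont hd' hnn hlim]
  congr 1
  simp

open MeasureTheory ENNReal in
lemma lintegral_Ioc_mul_inv_one_sub_sq {R : ℝ} (h0 : 0 ≤ R) (h1 : R < 1) :
    ∫⁻ r in Set.Ioc 0 R, ENNReal.ofReal (r * (1 / 2 * (1 - r ^ 2)⁻¹)) =
      ENNReal.ofReal (1 / 4 * -Real.log (1 - R ^ 2)) := by
  have hpos : ∀ r ∈ Set.Icc 0 R, 0 < 1 - r ^ 2 := by
    intro r hr
    nlinarith [hr.1, hr.2]
  have hcont : ContinuousOn (fun r : ℝ => r * (1 / 2 * (1 - r ^ 2)⁻¹)) (Set.Icc 0 R) := by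
    refine continuousOn_id.mul (continuousOn_const.mul (ContinuousOn.inv₀ (by fun_prop) ?_))
    exact fun r hr => (hpos r hr).ne'
  have hd : ∀ r ∈ Set.uIcc 0 R, HasDerivAt (fun r : ℝ => 1 / 4 * -Real.log (1 - r ^ 2))
      (r * (1 / 2 * (1 - r ^ 2)⁻¹)) r := by
    intro r hr
    rw [Set.uIcc_of_le h0] at hr
    have h2 : HasDerivAt (fun r : ℝ => 1 - r ^ 2) (-(2 * r)) r := by
      simpa using ((hasDerivAt_id r).pow 2).const_sub 1
    refine ((h2.log (hpos r hr).ne').neg.const_mul (1 / 4)).congr_deriv ?_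
    have := (hpos r hr).ne'
    field_simp
    ring
  have hint := intervalIntegral.integral_eq_sub_of_hasDerivAt hd
    ((Set.uIcc_of_le h0 ▸ hcont : ContinuousOn _ (Set.uIcc 0 R)).intervalIntegrable)
  rw [← ofReal_integral_eq_lintegral_ofReal, ← intervalIntegral.integral_of_le h0, hint]
  · simp
  · exact hcont.integrableOn_Icc.mono_set Set.Ioc_subset_Icc_self
  · filter_upwards [ae_restrict_mem measurableSet_Ioc] with r hr
    have := hpos r ⟨hr.1.le, hr.2⟩
    have := hr.1.le
    change 0 ≤ r * (1 / 2 * (1 - r ^ 2)⁻¹)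
    positivity

lemma ratio_lt_one {α ψ : ℝ} (h1 : α < π / 2) (hψ : ψ ∈ Set.Ioo (-α) α) :
    0 ≤ cos α / cos ψ ∧ cos α / cos ψ < 1 := by
  have hα : 0 < α := by linarith [hψ.1, hψ.2]
  have hc : 0 < cos α := Real.cos_pos_of_mem_Ioo ⟨by linarith, h1⟩
  have hlt : cos α < cos ψ := by
    rw [← Real.cos_abs ψ]
    exact Real.cos_lt_cos_of_nonneg_of_le_pi_div_two (abs_nonneg _) h1.le (abs_lt.2 hψ)
  exact ⟨div_nonneg hc.le (hc.trans hlt).le, (div_lt_one (hc.trans hlt)).2 hlt⟩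

open MeasureTheory ENNReal in
lemma lintegral_log_one_sub_ratio_le {α : ℝ} (h0 : 0 < α) (h1 : α < π / 2) :
    ∫⁻ ψ in Set.Ioo (-α) α, ENNReal.ofReal (1 / 4 * -Real.log (1 - (cos α / cos ψ) ^ 2)) ≤
      ENNReal.ofReal (v₃ / 2) := by
  obtain ⟨hi, hval⟩ := integral_log_one_sub_ratio h0 h1
  have hle : -α ≤ α := by linarith
  rw [← ofReal_integral_eq_lintegral_ofReal, ← integral_Ioc_eq_integral_Ioo,
    integral_const_mul, ← intervalIntegral.integral_of_le hle, hval]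
  · refine ENNReal.ofReal_le_ofReal ?_
    have := lobachevsky_sum_le h0.le h1.le
    rw [v₃]
    linarith
  · exact ((hi.1.mono_set Set.Ioo_subset_Ioc_self).const_mul _)
  · filter_upwards [ae_restrict_mem measurableSet_Ioo] with ψ hψ
    obtain ⟨ha, hb⟩ := ratio_lt_one h1 hψ
    have : Real.log (1 - (cos α / cos ψ) ^ 2) ≤ 0 := by
      refine Real.log_nonpos ?_ ?_ <;> nlinarith
    change 0 ≤ 1 / 4 * -Real.log (1 - (cos α / cos ψ) ^ 2)
    linarith

/-- The shadow on the boundary plane of `frameCone e α`, with the ideal vertex of the cone at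
infinity: an isosceles triangle. -/
def isoscelesTriangle (α : ℝ) : Set (ℝ × ℝ) :=
  {z | z.1 ≤ cos α ∧ z.2 * cos α ≤ z.1 * sin α ∧ -(z.2 * cos α) ≤ z.1 * sin α}

lemma measurableSet_isoscelesTriangle (α : ℝ) : MeasurableSet (isoscelesTriangle α) := by
  change MeasurableSet ({z : ℝ × ℝ | z.1 ≤ cos α} ∩
    ({z | z.2 * cos α ≤ z.1 * sin α} ∩ {z | -(z.2 * cos α) ≤ z.1 * sin α}))
  exact (measurableSet_le (by fun_prop) (by fun_prop)).inter
    ((measurableSet_le (by fun_prop) (by fun_prop)).inter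
      (measurableSet_le (by fun_prop) (by fun_prop)))

lemma mem_Icc_of_polarCoord_symm_mem {α r ψ : ℝ} (h0 : 0 < α) (h1 : α < π / 2) (hr : 0 < r)
    (hψ : ψ ∈ Set.Ioo (-π) π) (h : polarCoord.symm (r, ψ) ∈ isoscelesTriangle α) :
    ψ ∈ Set.Icc (-α) α ∧ r ≤ cos α / cos ψ := by
  simp only [isoscelesTriangle, polarCoord_symm_apply, Set.mem_ofPred_eq] at h
  obtain ⟨ha, hb, hc⟩ := h
  have hψα : ψ ∈ Set.Icc (-α) α := by
    constructor
    · by_contra! hlt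
      have hs : sin (ψ + α) < 0 :=
        Real.sin_neg_of_neg_of_neg_pi_lt (by linarith) (by linarith [hψ.1])
      rw [Real.sin_add] at hs
      nlinarith
    · by_contra! hlt
      have hs : 0 < sin (ψ - α) :=
        Real.sin_pos_of_pos_of_lt_pi (by linarith) (by linarith [hψ.2])
      rw [Real.sin_sub] at hs
      nlinarith
  refine ⟨hψα, ?_⟩
  have hcos : 0 < cos ψ :=
    Real.cos_pos_of_mem_Ioo ⟨by linarith [hψα.1], by linarith [hψα.2]⟩
  exact (le_div_iff₀ hcos).2 ha

open MeasureTheory ENNReal in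
lemma lintegral_isoscelesTriangle_le {α : ℝ} (h0 : 0 < α) (h1 : α < π / 2) :
    ∫⁻ z in isoscelesTriangle α, ENNReal.ofReal (1 / 2 * (1 - (z.1 ^ 2 + z.2 ^ 2))⁻¹) ≤
      ENNReal.ofReal (v₃ / 2) := by
  let D : Set (ℝ × ℝ) := {p | 0 < p.1 ∧ p.2 ∈ Set.Icc (-α) α ∧ p.1 ≤ cos α / cos p.2}
  have hD : MeasurableSet D := by
    change MeasurableSet ({p : ℝ × ℝ | 0 < p.1} ∩
      (Prod.snd ⁻¹' Set.Icc (-α) α ∩ {p | p.1 ≤ cos α / cos p.2}))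
    exact (measurableSet_lt (by fun_prop) (by fun_prop)).inter
      ((measurable_snd measurableSet_Icc).inter (measurableSet_le (by fun_prop) (by fun_prop)))
  let F : ℝ × ℝ → ℝ≥0∞ :=
    D.indicator fun p => ENNReal.ofReal (p.1 * (1 / 2 * (1 - p.1 ^ 2)⁻¹))
  have hF : Measurable F := Measurable.indicator (by fun_prop) hD
  rw [← lintegral_indicator (measurableSet_isoscelesTriangle α), ← lintegral_comp_polarCoord_symm]
  have htarget : MeasurableSet polarCoord.target := polarCoord.open_target.measurableSet
  calc _ ≤ ∫⁻ p, F p := by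
        rw [← lintegral_indicator htarget]
        refine lintegral_mono fun p => ?_
        obtain ⟨r, ψ⟩ := p
        by_cases hp : (r, ψ) ∈ polarCoord.target
        · rw [Set.indicator_of_mem hp]
          rw [polarCoord_target] at hp
          have hr : 0 < r := hp.1
          by_cases hT : polarCoord.symm (r, ψ) ∈ isoscelesTriangle α
          · have hmem : (r, ψ) ∈ D := by
              obtain ⟨ha, hb⟩ := mem_Icc_of_polarCoord_symm_mem h0 h1 hr hp.2 hT
              exact ⟨hr, ha, hb⟩
            simp only [F]
            rw [Set.indicator_of_mem hT, Set.indicator_of_mem hmem, smul_eq_mul,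
              ← ENNReal.ofReal_mul hr.le]
            simp only [polarCoord_symm_apply]
            rw [show (r * cos ψ) ^ 2 + (r * sin ψ) ^ 2 = r ^ 2 by
              linear_combination r ^ 2 * Real.sin_sq_add_cos_sq ψ]
          · rw [Set.indicator_of_notMem hT]
            simp
        · rw [Set.indicator_of_notMem hp]
          exact zero_le
    _ = ∫⁻ ψ, ∫⁻ r, F (r, ψ) := by
        rw [Measure.volume_eq_prod, lintegral_prod_symm' _ hF]
    _ = ∫⁻ ψ in Set.Icc (-α) α, ∫⁻ r in Set.Ioc 0 (cos α / cos ψ),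
          ENNReal.ofReal (r * (1 / 2 * (1 - r ^ 2)⁻¹)) := by
        rw [← lintegral_indicator measurableSet_Icc]
        congr 1
        ext ψ
        by_cases hψ : ψ ∈ Set.Icc (-α) α
        · rw [Set.indicator_of_mem hψ, ← lintegral_indicator measurableSet_Ioc]
          congr 1
          ext r
          simp only [F, D, Set.indicator, Set.mem_ofPred_eq, Set.mem_Ioc]
          simp [hψ.1, hψ.2]
        · rw [Set.indicator_of_notMem hψ]
          have : ∀ r, F (r, ψ) = 0 := fun r => Set.indicator_of_notMem (fun h => hψ h.2.1) _
          simp [this]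
    _ = ∫⁻ ψ in Set.Ioo (-α) α, ENNReal.ofReal (1 / 4 * -Real.log (1 - (cos α / cos ψ) ^ 2)) := by
        rw [← restrict_Ioo_eq_restrict_Icc]
        refine setLIntegral_congr_fun measurableSet_Ioo fun ψ hψ => ?_
        obtain ⟨ha, hb⟩ := ratio_lt_one h1 hψ
        exact lintegral_Ioc_mul_inv_one_sub_sq ha hb
    _ ≤ _ := lintegral_log_one_sub_ratio_le h0 h1

/-- The affine slice of the image of `frameCone e α` in the coordinates `frameCoord e`. -/
def frameSlice (α : ℝ) : Set (Fin 3 → ℝ) :=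
  {p | 0 ≤ p 0 ∧ (p 1, p 2) ∈ isoscelesTriangle α ∧ 0 < 1 + 2 * p 0 - (p 1 ^ 2 + p 2 ^ 2)}

lemma measurableSet_frameSlice (α : ℝ) : MeasurableSet (frameSlice α) := by
  change MeasurableSet ({p : Fin 3 → ℝ | 0 ≤ p 0} ∩ ((fun p => (p 1, p 2)) ⁻¹' isoscelesTriangle α ∩
    {p | 0 < 1 + 2 * p 0 - (p 1 ^ 2 + p 2 ^ 2)}))
  refine (measurableSet_le (by fun_prop) (by fun_prop)).inter (MeasurableSet.inter ?_
    (measurableSet_lt (by fun_prop) (by fun_prop)))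
  exact (show Measurable fun p : Fin 3 → ℝ => (p 1, p 2) by fun_prop)
    (measurableSet_isoscelesTriangle α)

open MeasureTheory ENNReal in
lemma lintegral_frameSlice_le {α : ℝ} (h0 : 0 < α) (h1 : α < π / 2) :
    ∫⁻ p in frameSlice α, ENNReal.ofReal (((1 + 2 * p 0 - (p 1 ^ 2 + p 2 ^ 2)) ^ 2)⁻¹) ≤
      ENNReal.ofReal (v₃ / 2) := by
  let F : ℝ × ℝ × ℝ → ℝ≥0∞ := (Set.Ici 0 ×ˢ isoscelesTriangle α).indicator fun x =>
    ENNReal.ofReal (((1 + 2 * x.1 - (x.2.1 ^ 2 + x.2.2 ^ 2)) ^ 2)⁻¹)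
  have hF : Measurable F := Measurable.indicator (by fun_prop)
    (measurableSet_Ici.prod (measurableSet_isoscelesTriangle α))
  have hmp : MeasurePreserving (fun p : Fin 3 → ℝ => (p 0, (p 1, p 2))) volume volume :=
    ((MeasurePreserving.id volume).prod (volume_preserving_finTwoArrow ℝ)).comp
      (volume_preserving_piFinSuccAbove (fun _ : Fin 3 => ℝ) 0)
  have hc : 0 < cos α := Real.cos_pos_of_mem_Ioo ⟨by linarith, h1⟩
  have hne : ∀ᵐ z : ℝ × ℝ, z.1 ≠ cos α := by
    have : ∀ᵐ x : ℝ, x ≠ cos α := (Set.countable_singleton (cos α)).ae_notMem volume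
    exact Measure.quasiMeasurePreserving_fst.ae this
  calc _ ≤ ∫⁻ p : Fin 3 → ℝ, F (p 0, (p 1, p 2)) := by
        rw [← lintegral_indicator (measurableSet_frameSlice α)]
        refine lintegral_mono fun p => ?_
        by_cases hp : p ∈ frameSlice α
        · have hmem : (p 0, (p 1, p 2)) ∈ Set.Ici (0 : ℝ) ×ˢ isoscelesTriangle α :=
            ⟨hp.1, hp.2.1⟩
          simp only [F]
          rw [Set.indicator_of_mem hp, Set.indicator_of_mem hmem]
        · rw [Set.indicator_of_notMem hp]
          exact zero_le
    _ = ∫⁻ x, F x := hmp.lintegral_comp hF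
    _ = ∫⁻ z, ∫⁻ b, F (b, z) := by
        rw [Measure.volume_eq_prod, lintegral_prod_symm' _ hF]
    _ ≤ ∫⁻ z in isoscelesTriangle α, ENNReal.ofReal (1 / 2 * (1 - (z.1 ^ 2 + z.2 ^ 2))⁻¹) := by
        rw [← lintegral_indicator (measurableSet_isoscelesTriangle α)]
        refine lintegral_mono_ae ?_
        filter_upwards [hne] with z hz
        by_cases hT : z ∈ isoscelesTriangle α
        · have hlt : z.1 ^ 2 + z.2 ^ 2 < 1 := by
            obtain ⟨ha, hb, hd⟩ := hT
            have hs : 0 < sin α := Real.sin_pos_of_pos_of_lt_pi h0 (by linarith)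
            have hz1 : 0 ≤ z.1 := by nlinarith
            have hz2 : z.1 ^ 2 < cos α ^ 2 :=
              pow_lt_pow_left₀ (lt_of_le_of_ne ha hz) hz1 two_ne_zero
            have hz3 : (z.2 * cos α) ^ 2 ≤ (z.1 * sin α) ^ 2 := sq_le_sq' (by linarith) hb
            have hsc := Real.sin_sq_add_cos_sq α
            have h5 : (z.1 ^ 2 + z.2 ^ 2) * cos α ^ 2 < 1 * cos α ^ 2 := by nlinarith
            exact lt_of_mul_lt_mul_right h5 (sq_nonneg _)
          rw [Set.indicator_of_mem hT, ← lintegral_Ioi_inv_sq_affine hlt,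
            restrict_Ioi_eq_restrict_Ici, ← lintegral_indicator measurableSet_Ici]
          refine lintegral_mono fun b => ?_
          simp only [F, Set.indicator, Set.mem_prod, hT, and_true]
          exact le_rfl
        · have : ∀ b, F (b, z) = 0 := fun b => Set.indicator_of_notMem (fun h => hT h.2) _
          simp [this]
    _ ≤ _ := lintegral_isoscelesTriangle_le h0 h1

lemma mink_kleinLift_self (p : EuclideanSpace ℝ (Fin 3)) :
    mink (kleinLift p) (kleinLift p) = ‖p‖ ^ 2 - 1 := by
  rw [EuclideanSpace.norm_sq_eq, Fin.sum_univ_three]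
  simp [mink, kleinLift]
  ring

lemma frameCoord_mem_cone {e : Fin 4 → Fin 4 → ℝ} (he : IsLorentzFrame e) {α : ℝ}
    {x : Fin 4 → ℝ} (hx : x ∈ frameCone e α) (hneg : mink x x < 0) (hgt : -1 < mink x x) :
    0 < frameCoord e x 0 ∧
      (frameCoord e x 0)⁻¹ • Fin.tail (frameCoord e x) ∈ frameSlice α ∧
      frameCoord e x 0 ^ 2 * (1 + 2 * ((frameCoord e x 0)⁻¹ • Fin.tail (frameCoord e x)) 0 -
        (((frameCoord e x 0)⁻¹ • Fin.tail (frameCoord e x)) 1 ^ 2 +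
          ((frameCoord e x 0)⁻¹ • Fin.tail (frameCoord e x)) 2 ^ 2)) < 1 := by
  obtain ⟨h1, h2, h3, h4, h5⟩ := hx
  have hq := he.mink_self_eq x
  set t := -mink (e 0) x - mink (e 3) x with ht
  have hinv : 0 < t⁻¹ := inv_pos.2 h1
  have hc0 : frameCoord e x 0 = t := rfl
  have ht0 : ((frameCoord e x 0)⁻¹ • Fin.tail (frameCoord e x)) 0 = t⁻¹ * mink (e 3) x := rfl
  have ht1 : ((frameCoord e x 0)⁻¹ • Fin.tail (frameCoord e x)) 1 = t⁻¹ * mink (e 1) x := rfl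
  have ht2 : ((frameCoord e x 0)⁻¹ • Fin.tail (frameCoord e x)) 2 = t⁻¹ * mink (e 2) x := rfl
  have hform : t ^ 2 * (1 + 2 * (t⁻¹ * mink (e 3) x) -
      ((t⁻¹ * mink (e 1) x) ^ 2 + (t⁻¹ * mink (e 2) x) ^ 2)) = -mink x x := by
    rw [hq]
    field_simp
    rw [ht]
    ring
  refine ⟨h1, ⟨?_, ⟨?_, ?_, ?_⟩, ?_⟩, ?_⟩
  · rw [ht0]; positivity
  · change ((frameCoord e x 0)⁻¹ • Fin.tail (frameCoord e x)) 1 ≤ cos α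
    rw [ht1, inv_mul_le_iff₀ h1]
    linarith
  · change ((frameCoord e x 0)⁻¹ • Fin.tail (frameCoord e x)) 2 * cos α ≤
      ((frameCoord e x 0)⁻¹ • Fin.tail (frameCoord e x)) 1 * sin α
    rw [ht1, ht2, mul_assoc, mul_assoc]
    exact mul_le_mul_of_nonneg_left h4 hinv.le
  · change -(((frameCoord e x 0)⁻¹ • Fin.tail (frameCoord e x)) 2 * cos α) ≤
      ((frameCoord e x 0)⁻¹ • Fin.tail (frameCoord e x)) 1 * sin α
    rw [ht1, ht2, mul_assoc, mul_assoc, ← mul_neg]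
    exact mul_le_mul_of_nonneg_left h5 hinv.le
  · rw [ht0, ht1, ht2]
    refine pos_of_mul_pos_right (a := t ^ 2) ?_ (sq_nonneg t)
    rw [hform]
    linarith
  · rw [ht0, ht1, ht2, hc0, hform]
    linarith

lemma kleinLift_mem_frameCone_of_mem_convexHull {Δ : GeodesicSimplex3} {e : Fin 4 → Fin 4 → ℝ}
    {α : ℝ} (h : ∀ a, kleinLift (Δ.v a) ∈ frameCone e α) {p : EuclideanSpace ℝ (Fin 3)}
    (hp : p ∈ convexHull ℝ (Set.range Δ.v)) : kleinLift p ∈ frameCone e α := by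
  have hconv : Convex ℝ {p | kleinLift p ∈ frameCone e α} := by
    rw [convex_iff_forall_pos]
    intro p hp q hq a b ha hb hab
    have : kleinLift (a • p + b • q) = a • kleinLift p + b • kleinLift q := by
      ext i
      fin_cases i <;> simp [kleinLift, hab]
    rw [Set.mem_ofPred_eq, this]
    exact frameCone_add (frameCone_smul ha hp) (frameCone_smul hb hq)
  refine convexHull_min ?_ hconv hp
  rintro _ ⟨a, rfl⟩
  exact h a

lemma norm_lt_one_of_mem_convexHull (Δ : GeodesicSimplex3) {p : EuclideanSpace ℝ (Fin 3)}
    (hp : p ∈ convexHull ℝ (Set.range Δ.v)) : ‖p‖ < 1 := by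
  have : Set.range Δ.v ⊆ Metric.ball 0 1 := by
    rintro _ ⟨a, rfl⟩
    simpa using Δ.mem_ball a
  simpa using convexHull_min this (convex_ball 0 1) hp

open MeasureTheory ENNReal in
lemma lintegral_convexHull_le {Δ : GeodesicSimplex3} {e : Fin 4 → Fin 4 → ℝ}
    (he : IsLorentzFrame e) {α : ℝ} (h : ∀ a, kleinLift (Δ.v a) ∈ frameCone e α) :
    ∫⁻ x in convexHull ℝ (Set.range Δ.v), ENNReal.ofReal (((1 - ‖x‖ ^ 2) ^ 2)⁻¹) ≤
      ∫⁻ p in frameSlice α, ENNReal.ofReal (((1 + 2 * p 0 - (p 1 ^ 2 + p 2 ^ 2)) ^ 2)⁻¹) := by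
  have hC : MeasurableSet (convexHull ℝ (Set.range Δ.v)) :=
    ((Set.finite_range Δ.v).isCompact_convexHull ℝ).isClosed.measurableSet
  set C := convexHull ℝ (Set.range Δ.v)
  have hmp := PiLp.volume_preserving_toLp (Fin 3)
  rw [← hmp.setLIntegral_comp_preimage hC (by fun_prop)]
  have hs : MeasurableSet (WithLp.toLp 2 ⁻¹' C : Set (Fin 3 → ℝ)) := hmp.measurable hC
  have hpos : ∀ p : Fin 3 → ℝ, p ∈ WithLp.toLp 2 ⁻¹' C → 0 < 1 - ‖WithLp.toLp 2 p‖ ^ 2 := by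
    intro p hp
    have := norm_lt_one_of_mem_convexHull Δ hp
    nlinarith [norm_nonneg (WithLp.toLp 2 p)]
  have h1 := volume_cone hs (g := fun p => 1 - ‖WithLp.toLp 2 p‖ ^ 2) (by fun_prop) hpos
  have h2 := volume_cone (measurableSet_frameSlice α)
    (g := fun p => 1 + 2 * p 0 - (p 1 ^ 2 + p 2 ^ 2)) (by fun_prop) (fun p hp => hp.2.2)
  have hdet : LinearMap.det (frameCoord e) ≠ 0 := by
    rw [← abs_pos, he.abs_det_frameCoord]
    exact one_pos
  have h3 := Measure.addHaar_preimage_linearMap volume hdet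
    {x : Fin 4 → ℝ | 0 < x 0 ∧ (x 0)⁻¹ • Fin.tail x ∈ frameSlice α ∧
      x 0 ^ 2 * (fun p : Fin 3 → ℝ => 1 + 2 * p 0 - (p 1 ^ 2 + p 2 ^ 2))
        ((x 0)⁻¹ • Fin.tail x) < 1}
  rw [abs_inv, he.abs_det_frameCoord, inv_one, ENNReal.ofReal_one, one_mul, h2] at h3
  have hdiv : ∀ a b : ℝ≥0∞, a / 4 ≤ b / 4 → a ≤ b := by
    intro a b hab
    rwa [ENNReal.div_le_iff (by norm_num) (by norm_num),
      ENNReal.div_mul_cancel (by norm_num) (by norm_num)] at hab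
  refine hdiv _ _ ?_
  rw [← h1, ← h3]
  refine measure_mono ?_
  rintro x ⟨hx0, hxC, hlt⟩
  set y := (x 0)⁻¹ • Fin.tail x with hy
  have hxy : x = x 0 • kleinLift (WithLp.toLp 2 y) := by
    ext i
    fin_cases i <;> simp [kleinLift, hy, Fin.tail, hx0.ne']
  have hmink : mink x x = -(x 0 ^ 2 * (1 - ‖WithLp.toLp 2 y‖ ^ 2)) := by
    have : mink x x =
        x 0 * (x 0 * mink (kleinLift (WithLp.toLp 2 y)) (kleinLift (WithLp.toLp 2 y))) := by
      rw [← mink_smul_right, ← mink_smul_left, ← hxy]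
    rw [this, mink_kleinLift_self]
    ring
  have hcone : x ∈ frameCone e α := by
    rw [hxy]
    exact frameCone_smul hx0 (kleinLift_mem_frameCone_of_mem_convexHull h hxC)
  have hgpos := mul_pos (pow_pos hx0 2) (hpos y hxC)
  refine frameCoord_mem_cone he hcone ?_ ?_
  · rw [hmink]; linarith
  · rw [hmink]; linarith

/-- If `Δ` is a 2-obtuse geodesic 3-simplex in hyperbolic 3-space —
nondegenerate, with nonideal vertices, having two edges sharing a vertex `p` which both
subtend nonacute dihedral angles — then `vol(Δ) ≤ v₃/2`. -/
theorem two_obtuse_volume_le_half (Δ : GeodesicSimplex3)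
    (h : ∃ p i j : Fin 4, i ≠ j ∧ p ≠ i ∧ p ≠ j ∧
      SubtendsNonacute Δ p i ∧ SubtendsNonacute Δ p j) :
    Δ.volume ≤ v₃ / 2 := by

  obtain ⟨α, hα, e, he, hcone⟩ := exists_frameCone Δ h
  rw [GeodesicSimplex3.volume, hypVolume, MeasureTheory.integral_eq_lintegral_of_nonneg_ae
    (Filter.Eventually.of_forall fun x => inv_nonneg.2 (sq_nonneg _))
    (Measurable.aestronglyMeasurable (by fun_prop))]
  refine ENNReal.toReal_le_of_le_ofReal (by linarith [v₃_nonneg]) ?_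
  exact (lintegral_convexHull_le he hcone).trans (lintegral_frameSlice_le hα.1 hα.2)

end
end
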